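/- arXiv:2508.08212 — 11 statements merged into one kernel-verified Lean document; each statement's English description precedes it below -/
import Mathlib

section
/- Let (K_j)_{j∈ℕ} be a sequence of nonempty closed subsets of [0,1] and let K ⊆ [0,1] be a nonempty closed set. If the Hausdorff distance d_H(K_j, K) tends to 0 as j → ∞ and the Lebesgue measures converge, λ(K_j) → λ(K), then the indicator functions converge in L¹: ∫₀¹ |𝟙_{K_j}(x) − 𝟙_K(x)| dx → 0 as j → ∞. -/
open MeasureTheory Filter

/-- If nonempty closed subsets `K j` of `[0,1]` converge to a nonempty closed set `K₀ ⊆ [0,1]`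
in the Hausdorff distance, and their Lebesgue measures converge to that of `K₀`, then the
indicator functions converge in `L¹`. -/
theorem stmt_0 (K : ℕ → Set ℝ) (K₀ : Set ℝ)
    (hKsub : ∀ j, K j ⊆ Set.Icc 0 1) (hKcl : ∀ j, IsClosed (K j))
    (hKne : ∀ j, (K j).Nonempty)
    (h₀sub : K₀ ⊆ Set.Icc 0 1) (h₀cl : IsClosed K₀) (h₀ne : K₀.Nonempty)
    (hH : Tendsto (fun j => Metric.hausdorffDist (K j) K₀) atTop (nhds 0))
    (hvol : Tendsto (fun j => volume (K j)) atTop (nhds (volume K₀))) :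
    Tendsto (fun j => ∫ x in Set.Icc (0:ℝ) 1,
        |(K j).indicator (fun _ => (1:ℝ)) x - K₀.indicator (fun _ => (1:ℝ)) x|)
      atTop (nhds 0) := by
  have hK₀c : IsCompact K₀ := isCompact_Icc.of_isClosed_subset h₀cl h₀sub
  set C : ℕ → Set ℝ := fun j => Metric.cthickening (Metric.hausdorffDist (K j) K₀) K₀ with hC
  have hCvol : Tendsto (fun j => volume (C j)) atTop (nhds (volume K₀)) :=
    (tendsto_measure_cthickening_of_isCompact hK₀c).comp hH
  have hfin₀ : volume K₀ ≠ ⊤ := hK₀c.measure_lt_top.ne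
  have h1 : Tendsto (fun j => (volume (C j)).toReal) atTop (nhds (volume K₀).toReal) :=
    (ENNReal.tendsto_toReal hfin₀).comp hCvol
  have h2 : Tendsto (fun j => (volume (K j)).toReal) atTop (nhds (volume K₀).toReal) :=
    (ENNReal.tendsto_toReal hfin₀).comp hvol
  have hlim : Tendsto (fun j => 2 * (volume (C j)).toReal - (volume (K j)).toReal
      - (volume K₀).toReal) atTop (nhds 0) := by
    have := ((h1.const_mul 2).sub h2).sub_const (volume K₀).toReal
    convert this using 2
    ring
  refine squeeze_zero (fun j => integral_nonneg fun x => abs_nonneg _) (fun j => ?_) hlim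
  have hKC : K j ⊆ C j := by
    intro x hx
    have hne := Metric.hausdorffEDist_ne_top_of_nonempty_of_bounded (hKne j) h₀ne
      (Metric.isBounded_Icc 0 1 |>.subset (hKsub j)) hK₀c.isBounded
    refine Metric.mem_cthickening_iff.2 ?_
    rw [Metric.hausdorffDist, ENNReal.ofReal_toReal hne]
    exact Metric.infEDist_le_hausdorffEDist_of_mem hx
  have h0C : K₀ ⊆ C j := Metric.self_subset_cthickening K₀
  have hCm : MeasurableSet (C j) := Metric.isClosed_cthickening.measurableSet
  have hint : ∀ A : Set ℝ, MeasurableSet A →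
      Integrable (A.indicator fun _ => (1:ℝ)) (volume.restrict (Set.Icc (0:ℝ) 1)) :=
    fun A hA => (integrable_const (1:ℝ)).indicator hA
  have hval : ∀ A : Set ℝ, MeasurableSet A → A ⊆ Set.Icc 0 1 →
      ∫ x in Set.Icc (0:ℝ) 1, A.indicator (fun _ => (1:ℝ)) x = (volume A).toReal := by
    intro A hA hs
    rw [integral_indicator_const _ hA]
    simp [measureReal_def, Measure.restrict_apply hA, Set.inter_eq_left.2 hs]
  have hvalC : ∫ x in Set.Icc (0:ℝ) 1, (C j).indicator (fun _ => (1:ℝ)) x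
      ≤ (volume (C j)).toReal := by
    rw [integral_indicator_const _ hCm]
    simp only [measureReal_def, smul_eq_mul, mul_one]
    exact ENNReal.toReal_mono hK₀c.cthickening.measure_lt_top.ne (Measure.restrict_apply_le _ _)
  have iC := hint _ hCm
  have iK := hint _ (hKcl j).measurableSet
  have i0 := hint _ h₀cl.measurableSet
  calc _ ≤ ∫ x in Set.Icc (0:ℝ) 1, (2 * (C j).indicator (fun _ => (1:ℝ)) x
        - (K j).indicator (fun _ => (1:ℝ)) x - K₀.indicator (fun _ => (1:ℝ)) x) := by
        refine integral_mono (iK.sub i0).abs (((iC.const_mul 2).sub iK).sub i0) fun x => ?_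
        have a := @hKC x
        have b := @h0C x
        by_cases hx : x ∈ K j <;> by_cases hy : x ∈ K₀ <;> by_cases hz : x ∈ C j <;>
          simp_all <;> norm_num
    _ = 2 * (∫ x in Set.Icc (0:ℝ) 1, (C j).indicator (fun _ => (1:ℝ)) x)
        - (∫ x in Set.Icc (0:ℝ) 1, (K j).indicator (fun _ => (1:ℝ)) x)
        - ∫ x in Set.Icc (0:ℝ) 1, K₀.indicator (fun _ => (1:ℝ)) x := by
        have e := integral_sub ((iC.const_mul 2).sub iK) i0
        simp only [Pi.sub_apply] at e
        rw [e, integral_sub (iC.const_mul 2) iK,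
          integral_const_mul]
    _ ≤ _ := by
        rw [hval _ (hKcl j).measurableSet (hKsub j), hval _ h₀cl.measurableSet h₀sub]
        linarith
end

section
/- Let X be a metric space, B ⊆ X a closed set, K ⊆ [0,1] a nonempty compact set, and δ > 0. Then the set A_K^δ := {θ ∈ C([0,1],X) : θ⁻¹(B) ⊆ K^δ} is open in C([0,1],X), where K^δ := {s ∈ [0,1] : dist(s,K) < δ} is the open δ-thickening of K in [0,1]. -/
/-- For a closed set `B ⊆ X`, a nonempty compact set `K ⊆ [0,1]` and `δ > 0`, the set
`A_K^δ = {θ ∈ C([0,1],X) : θ⁻¹(B) ⊆ K^δ}` is open in `C([0,1],X)`, where `K^δ` is the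
open `δ`-thickening of `K` in `[0,1]`. -/
theorem stmt_2 {X : Type*} [MetricSpace X] (B : Set X) (hB : IsClosed B)
    (K : Set ↥(Set.Icc (0:ℝ) 1)) (hK : IsCompact K) (hKne : K.Nonempty)
    (δ : ℝ) (hδ : 0 < δ) :
    IsOpen {θ : C(↥(Set.Icc (0:ℝ) 1), X) | ⇑θ ⁻¹' B ⊆ Metric.thickening δ K} := by
  have hc : IsCompact (Metric.thickening δ K)ᶜ :=
    Metric.isOpen_thickening.isClosed_compl.isCompact
  convert ContinuousMap.isOpen_setOfPred_mapsTo (X := ↥(Set.Icc (0:ℝ) 1)) hc hB.isOpen_compl using 1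
  ext θ
  constructor
  · intro h x hx hb
    exact hx (h hb)
  · intro h x hb
    by_contra hx
    exact h hx hb
end

section
/- Let X be a metric space, B ⊆ X a closed set, K ⊆ [0,1] a nonempty compact set, and δ > 0. Then the set C_K^δ := {θ ∈ C([0,1],X) : K ⊆ closure({s ∈ [0,1] : dist(s, θ⁻¹(B)) < δ})} is closed in C([0,1],X). -/
theorem aux_mem (δ : ℝ) (hδ : 0 < δ) (E : Set ↥(Set.Icc (0:ℝ) 1)) (hE : IsClosed E)
    (s : ↥(Set.Icc (0:ℝ) 1)) :
    s ∈ closure (Metric.thickening δ E) ↔ ∃ e ∈ E, dist s e ≤ δ := by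
  constructor
  · intro h
    have h1 := Metric.closure_thickening_subset_cthickening δ E h
    rw [hE.isCompact.cthickening_eq_biUnion_closedBall hδ.le] at h1
    simpa using h1
  · rintro ⟨e, he, hd⟩
    rw [Metric.mem_closure_iff]
    intro ε hε
    obtain ⟨t, ht0, ht1, htε⟩ : ∃ t : ℝ, 0 < t ∧ t ≤ 1 ∧ t < ε :=
      ⟨min 1 (ε / 2), by positivity, min_le_left _ _, (min_le_right _ _).trans_lt (by linarith)⟩
    have hs := s.2
    have hee := e.2
    have hmem : (1 - t) * (s : ℝ) + t * (e : ℝ) ∈ Set.Icc (0:ℝ) 1 :=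
      (convex_Icc (0:ℝ) 1) hs hee (by linarith) ht0.le (by ring)
    rw [Subtype.dist_eq, Real.dist_eq] at hd
    refine ⟨⟨_, hmem⟩, ?_, ?_⟩
    · rw [Metric.mem_thickening_iff]
      refine ⟨e, he, ?_⟩
      rw [Subtype.dist_eq, Real.dist_eq]
      have : (1 - t) * (s : ℝ) + t * (e : ℝ) - e = (1 - t) * (s - e) := by ring
      simp only [this, abs_mul, abs_of_nonneg (sub_nonneg.2 ht1)]
      nlinarith [mul_le_mul_of_nonneg_left hd (sub_nonneg.2 ht1), mul_pos ht0 hδ]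
    · rw [Subtype.dist_eq, Real.dist_eq]
      have : (s : ℝ) - ((1 - t) * (s : ℝ) + t * (e : ℝ)) = t * (s - e) := by ring
      simp only [this, abs_mul, abs_of_pos ht0]
      have h1 : |(s : ℝ) - e| ≤ 1 := by
        rw [abs_le]; constructor <;> linarith [hs.1, hs.2, hee.1, hee.2]
      nlinarith

/-- For a closed set `B ⊆ X`, a nonempty compact set `K ⊆ [0,1]` and `δ > 0`, the set
`C_K^δ = {θ ∈ C([0,1],X) : K ⊆ closure((θ⁻¹(B))^δ)}` is closed in `C([0,1],X)`, where
`(·)^δ` denotes the open `δ`-thickening in `[0,1]` (the thickening of `∅` being `∅`). -/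
theorem stmt_3 {X : Type*} [MetricSpace X] (B : Set X) (hB : IsClosed B)
    (K : Set ↥(Set.Icc (0:ℝ) 1)) (hK : IsCompact K) (hKne : K.Nonempty)
    (δ : ℝ) (hδ : 0 < δ) :
    IsClosed {θ : C(↥(Set.Icc (0:ℝ) 1), X) |
      K ⊆ closure (Metric.thickening δ (⇑θ ⁻¹' B))} := by
  have key : {θ : C(↥(Set.Icc (0:ℝ) 1), X) |
      K ⊆ closure (Metric.thickening δ (⇑θ ⁻¹' B))} =
      ⋂ s ∈ K, Prod.fst '' {p : C(↥(Set.Icc (0:ℝ) 1), X) × ↥(Set.Icc (0:ℝ) 1) |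
        p.1 p.2 ∈ B ∧ dist s p.2 ≤ δ} := by
    ext θ
    simp only [Set.mem_ofPred_eq, Set.mem_iInter, Set.subset_def]
    refine forall₂_congr fun s _ => ?_
    rw [aux_mem δ hδ _ (hB.preimage θ.continuous)]
    constructor
    · rintro ⟨e, he, hd⟩
      exact ⟨(θ, e), ⟨he, hd⟩, rfl⟩
    · rintro ⟨⟨θ', e⟩, ⟨he, hd⟩, rfl⟩
      exact ⟨e, he, hd⟩
  rw [key]
  refine isClosed_biInter fun s _ => isClosedMap_fst_of_compactSpace _ ?_
  have h1 : IsClosed {p : C(↥(Set.Icc (0:ℝ) 1), X) × ↥(Set.Icc (0:ℝ) 1) | p.1 p.2 ∈ B} :=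
    hB.preimage (f := fun p : C(↥(Set.Icc (0:ℝ) 1), X) × ↥(Set.Icc (0:ℝ) 1) => p.1 p.2)
      (by fun_prop)
  have h2 : IsClosed {p : C(↥(Set.Icc (0:ℝ) 1), X) × ↥(Set.Icc (0:ℝ) 1) | dist s p.2 ≤ δ} :=
    isClosed_le (by fun_prop) continuous_const
  exact h1.and h2
end

section
/- Let X be a metric space, B ⊆ X a closed set, and K ⊆ [0,1] a compact set. Then the map θ ↦ d_H(θ⁻¹(B), K), sending a continuous curve to the extended Hausdorff distance (valued in [0,∞]) between its preimage of B and K, is Borel measurable from C([0,1],X) to [0,∞]. -/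
theorem meas_mapsTo_aux {X : Type*} [MetricSpace X]
    [MeasurableSpace C(↥(Set.Icc (0:ℝ) 1), X)] [BorelSpace C(↥(Set.Icc (0:ℝ) 1), X)]
    (B : Set X) (hB : IsClosed B) (U : Set ↥(Set.Icc (0:ℝ) 1)) (hU : IsOpen U) :
    MeasurableSet {θ : C(↥(Set.Icc (0:ℝ) 1), X) | Set.MapsTo θ U Bᶜ} := by
  obtain ⟨F, hF, -, hFU, -⟩ := hU.exists_iUnion_isClosed
  have : {θ : C(↥(Set.Icc (0:ℝ) 1), X) | Set.MapsTo θ U Bᶜ}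
      = ⋂ n, {θ : C(↥(Set.Icc (0:ℝ) 1), X) | Set.MapsTo θ (F n) Bᶜ} := by
    ext θ
    simp only [Set.mem_setOf_eq, Set.mem_iInter]
    rw [← hFU, Set.mapsTo_iUnion]
  rw [this]
  exact MeasurableSet.iInter fun n =>
    (ContinuousMap.isOpen_setOf_mapsTo (hF n).isCompact hB.isOpen_compl).measurableSet

/-- For a closed set `B ⊆ X` and a compact set `K ⊆ [0,1]`, the map sending a continuous
curve `θ ∈ C([0,1],X)` to the extended Hausdorff distance between `θ⁻¹(B)` and `K`
(valued in `[0,∞]`) is Borel measurable. -/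
theorem stmt_4 {X : Type*} [MetricSpace X]
    [MeasurableSpace C(↥(Set.Icc (0:ℝ) 1), X)] [BorelSpace C(↥(Set.Icc (0:ℝ) 1), X)]
    (B : Set X) (hB : IsClosed B)
    (K : Set ↥(Set.Icc (0:ℝ) 1)) (hK : IsCompact K) :
    Measurable fun θ : C(↥(Set.Icc (0:ℝ) 1), X) =>
      EMetric.hausdorffEdist (⇑θ ⁻¹' B) K := by
  change Measurable fun θ : C(↥(Set.Icc (0:ℝ) 1), X) => Metric.hausdorffEDist (⇑θ ⁻¹' B) K
  simp only [Metric.hausdorffEDist_def]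
  refine Measurable.sup ?_ ?_
  · refine measurable_of_Iic fun c => ?_
    convert meas_mapsTo_aux B hB {x | c < Metric.infEDist x K}
      (isOpen_lt continuous_const Metric.continuous_infEDist) using 1
    ext θ
    simp only [Set.mem_preimage, Set.mem_Iic, iSup_le_iff, Set.mem_setOf_eq, Set.MapsTo,
      Set.mem_compl_iff]
    exact forall_congr' fun x => ⟨fun h h1 h2 => absurd (h h2) (not_le.2 h1),
      fun h h1 => not_lt.1 fun h2 => h h2 h1⟩
  · obtain ⟨D, hDK, hDc, hKD⟩ :=
      (TopologicalSpace.IsSeparable.of_separableSpace K).exists_countable_dense_subset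
    have : (fun θ : C(↥(Set.Icc (0:ℝ) 1), X) => ⨆ y ∈ K, Metric.infEDist y (⇑θ ⁻¹' B))
        = fun θ : C(↥(Set.Icc (0:ℝ) 1), X) => ⨆ y ∈ D, Metric.infEDist y (⇑θ ⁻¹' B) := by
      funext θ
      refine le_antisymm (iSup₂_le fun y hy => ?_) (biSup_mono fun y hy => hDK hy)
      have hc : IsClosed {y | Metric.infEDist y (⇑θ ⁻¹' B)
          ≤ ⨆ y ∈ D, Metric.infEDist y (⇑θ ⁻¹' B)} :=
        isClosed_le Metric.continuous_infEDist continuous_const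
      exact closure_minimal
        (fun z hz => le_iSup₂ (f := fun y (_ : y ∈ D) => Metric.infEDist y (⇑θ ⁻¹' B)) z hz)
        hc (hKD hy)
    rw [this]
    refine Measurable.biSup D hDc fun y _ => measurable_of_Ici fun c => ?_
    convert meas_mapsTo_aux B hB {x | edist y x < c}
      (isOpen_lt (by fun_prop) continuous_const) using 1
    ext θ
    simp only [Set.mem_preimage, Set.mem_Ici, Metric.le_infEDist, Set.mem_setOf_eq, Set.MapsTo,
      Set.mem_compl_iff]
    exact forall_congr' fun x => ⟨fun h h1 h2 => absurd (h h2) (not_le.2 h1),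
      fun h h1 => not_lt.1 fun h2 => h h2 h1⟩
end

section
/- Let X be a metric space and B ⊆ X a closed set. Then the map θ ↦ λ(θ⁻¹(B)), sending a continuous curve θ : [0,1] → X to the Lebesgue measure of the preimage θ⁻¹(B), is upper semicontinuous on C([0,1],X). -/
open MeasureTheory

/-- For a closed set `B ⊆ X`, the map sending a continuous curve `θ ∈ C([0,1],X)` to the
Lebesgue measure of the preimage `θ⁻¹(B)` (viewed as a subset of `ℝ` via the inclusion
`[0,1] ⊆ ℝ`) is upper semicontinuous. -/
theorem stmt_5 {X : Type*} [MetricSpace X] (B : Set X) (hB : IsClosed B) :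
    UpperSemicontinuous fun θ : C(↥(Set.Icc (0:ℝ) 1), X) =>
      volume (Subtype.val '' (⇑θ ⁻¹' B)) := by
  intro θ y hy
  obtain ⟨U, hKU, hU, hUy⟩ := Set.exists_isOpen_lt_of_lt _ y hy
  have hC : IsCompact ((Subtype.val ⁻¹' U : Set ↥(Set.Icc (0:ℝ) 1))ᶜ) :=
    (hU.preimage continuous_subtype_val).isClosed_compl.isCompact
  have hθ : Set.MapsTo θ ((Subtype.val ⁻¹' U : Set ↥(Set.Icc (0:ℝ) 1))ᶜ) Bᶜ :=
    fun x hx hxB => hx (hKU ⟨x, hxB, rfl⟩)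
  filter_upwards [ContinuousMap.eventually_mapsTo hC hB.isOpen_compl hθ] with η hη
  refine lt_of_le_of_lt (measure_mono ?_) hUy
  rintro _ ⟨x, hx, rfl⟩
  by_contra h
  exact hη h hx
end

section
/- Let K ⊆ [0,1] be a Borel set with λ(K) > 0. Then the transport parametrization u_K satisfies: (1) u_K is monotone nondecreasing and right-continuous, and f_K(u_K(t)) = t for every t ∈ [0,1); (2) u_K(t) ∈ K for λ-almost every t ∈ (0,1); (3) for λ-almost every t ∈ (0,1) the derivative of u_K at t exists and equals λ(K); (4) the pushforward under u_K of Lebesgue measure restricted to (0,1) equals λ(K)⁻¹ times Lebesgue measure restricted to K. -/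
open MeasureTheory

/-- `fK K x = λ(K ∩ [0,x]) / λ(K)`. -/
noncomputable def fK (K : Set ℝ) (x : ℝ) : ℝ :=
  (volume (K ∩ Set.Icc 0 x)).toReal / (volume K).toReal

/-- The transport parametrization `uK K t = inf {x ∈ [0,1] : fK K x > t}`. -/
noncomputable def uK (K : Set ℝ) (t : ℝ) : ℝ :=
  sInf {x ∈ Set.Icc (0:ℝ) 1 | t < fK K x}

theorem fK_integral (K : Set ℝ) (hK : MeasurableSet K) (hKsub : K ⊆ Set.Icc 0 1) (x : ℝ) :
    fK K x = (∫ t in (0:ℝ)..x, K.indicator (fun _ => (1:ℝ)) t) / (volume K).toReal := by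
  unfold fK
  congr 1
  rcases le_or_gt 0 x with hx | hx
  · rw [intervalIntegral.integral_of_le hx, ← integral_Icc_eq_integral_Ioc, integral_indicator hK,
      Measure.restrict_restrict hK] <;> simp [Measure.real]
  · rw [intervalIntegral.integral_of_ge hx.le, integral_indicator hK, Measure.restrict_restrict hK]
    have h : volume (K ∩ Set.Ioc x 0) = 0 := by
      refine measure_mono_null (t := {0}) ?_ (by simp)
      rintro y ⟨h1, h2⟩
      exact le_antisymm h2.2 (hKsub h1).1
    simp [Set.Icc_eq_empty_of_lt hx, Measure.real, h]

theorem stmt_6 (K : Set ℝ) (hK : MeasurableSet K) (hKsub : K ⊆ Set.Icc 0 1)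
    (hKpos : 0 < volume K) :
    (MonotoneOn (uK K) (Set.Ico 0 1) ∧
        (∀ t ∈ Set.Ico (0:ℝ) 1, ContinuousWithinAt (uK K) (Set.Ici t) t) ∧
        ∀ t ∈ Set.Ico (0:ℝ) 1, fK K (uK K t) = t) ∧
      (∀ᵐ t ∂(volume.restrict (Set.Ioo (0:ℝ) 1)), uK K t ∈ K) ∧
      (∀ᵐ t ∂(volume.restrict (Set.Ioo (0:ℝ) 1)),
        HasDerivAt (uK K) (volume K).toReal t) ∧
      Measure.map (uK K) (volume.restrict (Set.Ioo (0:ℝ) 1)) =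
        (volume K)⁻¹ • volume.restrict K := by
  have hfin : volume K ≠ ⊤ := ((measure_mono hKsub).trans_lt (by simp)).ne
  have hm : 0 < (volume K).toReal := ENNReal.toReal_pos hKpos.ne' hfin
  have hli : Integrable (K.indicator (fun _ => (1:ℝ))) volume :=
    (integrable_indicator_iff hK).2 (integrableOn_const hfin (by simp))
  have hint := fK_integral K hK hKsub
  have hcont : Continuous (fK K) := by
    rw [funext hint]
    exact (intervalIntegral.continuous_primitive (fun a b => hli.intervalIntegrable) 0).div_const _
  have hmono : Monotone (fK K) := by
    intro x y hxy
    unfold fK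
    have : volume (K ∩ Set.Icc 0 y) ≠ ⊤ := measure_ne_top_of_subset Set.inter_subset_left hfin
    gcongr
  have hF0 : fK K 0 = 0 := by rw [hint]; simp
  have hFle : ∀ x, fK K x ≤ 1 := by
    intro x
    unfold fK
    rw [div_le_one hm]
    gcongr
    exact Set.inter_subset_left
  have hF1 : fK K 1 = 1 := by
    unfold fK
    rw [Set.inter_eq_left.2 hKsub, div_self hm.ne']
  have hFnn : ∀ x, 0 ≤ fK K x := fun x => by unfold fK; positivity
  have hS1 : ∀ t ∈ Set.Ico (0:ℝ) 1, (1:ℝ) ∈ {x ∈ Set.Icc (0:ℝ) 1 | t < fK K x} := by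
    intro t ht
    refine ⟨by simp, ?_⟩
    rw [hF1]; exact ht.2
  have hbdd : ∀ t, BddBelow {x ∈ Set.Icc (0:ℝ) 1 | t < fK K x} := fun t => ⟨0, fun x hx => hx.1.1⟩
  have hlt1 : ∀ t ∈ Set.Ico (0:ℝ) 1, ∀ x, uK K t < x → t < fK K x := by
    intro t ht x hx
    obtain ⟨s, hs, hsx⟩ := exists_lt_of_csInf_lt ⟨1, hS1 t ht⟩ hx
    exact hs.2.trans_le (hmono hsx.le)
  have hFu : ∀ t ∈ Set.Ico (0:ℝ) 1, fK K (uK K t) = t := by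
    intro t ht
    apply le_antisymm
    · by_contra! h
      have h0 : 0 ≤ uK K t := le_csInf ⟨1, hS1 t ht⟩ (fun x hx => hx.1.1)
      have hpos : 0 < uK K t := by
        rcases h0.eq_or_lt with h' | h'
        · rw [← h', hF0] at h; exact absurd ht.1 (not_le.2 h)
        · exact h'
      have hev : ∀ᶠ x in nhdsWithin (uK K t) (Set.Iio (uK K t)), t < fK K x :=
        (hcont.continuousAt.eventually (lt_mem_nhds h)).filter_mono nhdsWithin_le_nhds
      have hev2 : ∀ᶠ x in nhdsWithin (uK K t) (Set.Iio (uK K t)), x ∈ Set.Ioo 0 (uK K t) :=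
        Ioo_mem_nhdsLT hpos
      obtain ⟨x, hx1, hx2⟩ := (hev.and hev2).exists
      have hle1 : uK K t ≤ 1 := csInf_le (hbdd t) (hS1 t ht)
      have : uK K t ≤ x := csInf_le (hbdd t) ⟨⟨hx2.1.le, hx2.2.le.trans hle1⟩, hx1⟩
      exact absurd hx2.2 (not_lt.2 this)
    · have : Filter.Tendsto (fK K) (nhdsWithin (uK K t) (Set.Ioi (uK K t))) (nhds (fK K (uK K t))) :=
        hcont.continuousAt.mono_left nhdsWithin_le_nhds
      refine ge_of_tendsto this ?_
      filter_upwards [self_mem_nhdsWithin] with x hx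
      exact (hlt1 t ht x hx).le
  have hlt2 : ∀ t ∈ Set.Ico (0:ℝ) 1, ∀ x, t < fK K x → uK K t < x := by
    intro t ht x hx
    by_contra! h
    have := hmono h
    rw [hFu t ht] at this
    linarith
  have hum : MonotoneOn (uK K) (Set.Ico 0 1) := by
    intro s hs t ht hst
    by_contra! h
    have := hlt1 t ht _ h
    rw [hFu s hs] at this
    linarith
  have hsub : Set.Ioo (0:ℝ) 1 ⊆ Set.Ico 0 1 := Set.Ioo_subset_Ico_self
  have hmeas : AEMeasurable (uK K) (volume.restrict (Set.Ioo (0:ℝ) 1)) :=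
    aemeasurable_restrict_of_monotoneOn measurableSet_Ioo (hum.mono hsub)
  have hmap : Measure.map (uK K) (volume.restrict (Set.Ioo (0:ℝ) 1)) =
        (volume K)⁻¹ • volume.restrict K := by
    have : IsFiniteMeasure (volume.restrict (Set.Ioo (0:ℝ) 1)) := ⟨by simp⟩
    have := Measure.isFiniteMeasure_map (volume.restrict (Set.Ioo (0:ℝ) 1)) (uK K)
    refine Measure.ext_of_Iic _ _ (fun x => ?_)
    have hR : ((volume K)⁻¹ • volume.restrict K) (Set.Iic x) = ENNReal.ofReal (fK K x) := by
      have hset : Set.Iic x ∩ K = K ∩ Set.Icc 0 x := by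
        ext y
        constructor
        · rintro ⟨h1, h2⟩; exact ⟨h2, (hKsub h2).1, h1⟩
        · rintro ⟨h1, h2⟩; exact ⟨h2.2, h1⟩
      have : volume (K ∩ Set.Icc 0 x) ≠ ⊤ := measure_ne_top_of_subset Set.inter_subset_left hfin
      rw [Measure.smul_apply, Measure.restrict_apply measurableSet_Iic, hset, fK,
        ENNReal.ofReal_div_of_pos hm, ENNReal.ofReal_toReal this, ENNReal.ofReal_toReal hfin,
        smul_eq_mul, mul_comm, div_eq_mul_inv]
    rw [hR, Measure.map_apply_of_aemeasurable hmeas measurableSet_Iic,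
      Measure.restrict_apply' measurableSet_Ioo]
    apply le_antisymm
    · calc _ ≤ volume (Set.Ioc 0 (fK K x)) := by
            apply measure_mono
            rintro t ⟨h1, h2⟩
            refine ⟨h2.1, ?_⟩
            rw [← hFu t (hsub h2)]
            exact hmono h1
        _ = _ := by simp
    · calc _ = volume (Set.Ioo 0 (fK K x)) := by simp
        _ ≤ _ := by
            apply measure_mono
            rintro t ⟨h1, h2⟩
            have h3 : t ∈ Set.Ioo (0:ℝ) 1 := ⟨h1, h2.trans_le (hFle x)⟩
            exact ⟨(hlt2 t (hsub h3) x h2).le, h3⟩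
  have hae : ∀ p : ℝ → Prop, (∀ᵐ x ∂(volume.restrict K), p x) →
      ∀ᵐ t ∂(volume.restrict (Set.Ioo (0:ℝ) 1)), p (uK K t) := by
    intro p hp
    apply ae_of_ae_map hmeas
    rw [hmap]
    exact Measure.ae_smul_measure hp _
  refine ⟨⟨hum, ?_, hFu⟩, hae (· ∈ K) (ae_restrict_mem hK), ?_, hmap⟩
  · intro t ht
    have hIco : ∀ b, t < b → Set.Ico t b ∈ nhdsWithin t (Set.Ici t) := fun b hb =>
      Ico_mem_nhdsGE hb
    refine tendsto_order.2 ⟨fun a ha => ?_, fun a ha => ?_⟩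
    · filter_upwards [hIco 1 ht.2] with s hs
      exact ha.trans_le (hum ht ⟨ht.1.trans hs.1, hs.2⟩ hs.1)
    · filter_upwards [hIco _ (hlt1 t ht a ha)] with s hs
      exact hlt2 s ⟨ht.1.trans hs.1, hs.2.trans_le (hFle a)⟩ a hs.2
  · have hd : ∀ᵐ x ∂(volume.restrict K), HasDerivAt (fK K) ((volume K).toReal)⁻¹ x := by
      rw [ae_restrict_iff' hK]
      filter_upwards [LocallyIntegrable.ae_hasDerivAt_integral hli.locallyIntegrable] with x hx hxK
      rw [funext hint]
      have := (hx 0).div_const (volume K).toReal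
      simpa [hxK] using this
    have hc : ∀ᵐ t ∂(volume.restrict (Set.Ioo (0:ℝ) 1)),
        t ∉ {x ∈ Set.Ico (0:ℝ) 1 | ¬ContinuousWithinAt (uK K) (Set.Ico 0 1) x} :=
      hum.countable_not_continuousWithinAt.ae_notMem _
    filter_upwards [hae _ hd, hc, ae_restrict_mem measurableSet_Ioo] with t h1 h2 h3
    have hn : Set.Ico (0:ℝ) 1 ∈ nhds t := Ico_mem_nhds h3.1 h3.2
    have hca : ContinuousAt (uK K) t := by
      have : ContinuousWithinAt (uK K) (Set.Ico 0 1) t := by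
        by_contra h
        exact h2 ⟨hsub h3, h⟩
      exact this.continuousAt hn
    have := HasDerivAt.of_local_left_inverse hca h1 (inv_ne_zero hm.ne')
      (Filter.mem_of_superset hn hFu)
    simpa using this
end

section
/- Let f, g : [0,1] → [0,1] be monotone nondecreasing functions, and define their pseudo-inverses f̂, ĝ : [0,1) → [0,1] by f̂(t) = inf{x ∈ [0,1] : f(x) > t} and ĝ(t) = inf{x ∈ [0,1] : g(x) > t}, with the convention inf ∅ = 1. Then ∫₀¹ |f(x) − g(x)| dx = ∫₀¹ |f̂(t) − ĝ(t)| dt. -/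
open MeasureTheory

lemma aux_Iio (a b : ℝ) (ha : a ∈ Set.Icc (0:ℝ) 1) (hb : b ∈ Set.Icc (0:ℝ) 1) :
    (volume.restrict (Set.Icc (0:ℝ) 1)) (symmDiff (Set.Iio a) (Set.Iio b))
      = ENNReal.ofReal |a - b| := by
  wlog h : a ≤ b generalizing a b
  · rw [symmDiff_comm, abs_sub_comm]
    exact this b a hb ha (le_of_not_ge h)
  have e : symmDiff (Set.Iio a) (Set.Iio b) = Set.Ico a b := by
    ext x
    simp only [Set.mem_symmDiff, Set.mem_Iio, Set.mem_Ico]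
    grind
  rw [e, Measure.restrict_apply measurableSet_Ico, Set.inter_eq_left.2, Real.volume_Ico,
    abs_sub_comm, abs_of_nonneg (sub_nonneg.2 h)]
  intro x hx
  exact ⟨ha.1.trans hx.1, hx.2.le.trans hb.2⟩

lemma aux_Ioi (a b : ℝ) (ha : a ∈ Set.Icc (0:ℝ) 1) (hb : b ∈ Set.Icc (0:ℝ) 1) :
    (volume.restrict (Set.Icc (0:ℝ) 1)) (symmDiff (Set.Ioi a) (Set.Ioi b))
      = ENNReal.ofReal |a - b| := by
  wlog h : a ≤ b generalizing a b
  · rw [symmDiff_comm, abs_sub_comm]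
    exact this b a hb ha (le_of_not_ge h)
  have e : symmDiff (Set.Ioi a) (Set.Ioi b) = Set.Ioc a b := by
    ext x
    simp only [Set.mem_symmDiff, Set.mem_Ioi, Set.mem_Ioc]
    grind
  rw [e, Measure.restrict_apply measurableSet_Ioc, Set.inter_eq_left.2, Real.volume_Ioc,
    abs_sub_comm, abs_of_nonneg (sub_nonneg.2 h)]
  intro x hx
  exact ⟨ha.1.trans hx.1.le, hx.2.trans hb.2⟩

lemma aux_bdd (f : ℝ → ℝ) (t : ℝ) :
    BddBelow (insert 1 {x ∈ Set.Icc (0:ℝ) 1 | t < f x}) := by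
  refine ⟨0, ?_⟩
  rintro x (rfl | hx)
  · norm_num
  · exact hx.1.1

lemma aux_mem_s7 (f : ℝ → ℝ) (t : ℝ) :
    sInf (insert 1 {x ∈ Set.Icc (0:ℝ) 1 | t < f x}) ∈ Set.Icc (0:ℝ) 1 := by
  constructor
  · apply le_csInf (Set.insert_nonempty _ _)
    rintro x (rfl | hx)
    · norm_num
    · exact hx.1.1
  · exact csInf_le (aux_bdd f t) (Set.mem_insert _ _)

lemma aux_mono (f : ℝ → ℝ) :
    Monotone (fun t => sInf (insert 1 {x ∈ Set.Icc (0:ℝ) 1 | t < f x})) := by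
  intro s t hst
  apply csInf_le_csInf (aux_bdd f s) (Set.insert_nonempty _ _)
  apply Set.insert_subset_insert
  intro x hx
  exact ⟨hx.1, hst.trans_lt hx.2⟩

lemma aux_slice (f F : ℝ → ℝ) (hf : MonotoneOn f (Set.Icc 0 1))
    (hF : ∀ x ∈ Set.Icc (0:ℝ) 1, F x = f x) (t : ℝ) :
    {x | t < F x} =ᵐ[volume.restrict (Set.Icc (0:ℝ) 1)]
      Set.Ioi (sInf (insert 1 {x ∈ Set.Icc (0:ℝ) 1 | t < f x})) := by
  set a := sInf (insert 1 {x ∈ Set.Icc (0:ℝ) 1 | t < f x}) with ha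
  have hne : ∀ᵐ x ∂(volume.restrict (Set.Icc (0:ℝ) 1)), x ≠ a :=
    Measure.ae_ne _ a
  filter_upwards [hne, ae_restrict_mem measurableSet_Icc] with x hx hxI
  apply propext
  change t < F x ↔ a < x
  rw [hF x hxI]
  constructor
  · intro h
    exact lt_of_le_of_ne (csInf_le (aux_bdd f t) (Or.inr ⟨hxI, h⟩)) (Ne.symm hx)
  · intro h
    obtain ⟨y, hy, hyx⟩ := exists_lt_of_csInf_lt (Set.insert_nonempty _ _) h
    rcases hy with rfl | hy
    · exact absurd hxI.2 (not_le.2 hyx)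
    · exact hy.2.trans_le (hf hy.1 hxI hyx.le)

lemma aux_ext (f : ℝ → ℝ) (hf : MonotoneOn f (Set.Icc 0 1)) :
    ∃ F : ℝ → ℝ, Measurable F ∧ ∀ x ∈ Set.Icc (0:ℝ) 1, F x = f x := by
  refine ⟨fun x => f (Set.projIcc 0 1 zero_le_one x), Monotone.measurable ?_, ?_⟩
  · intro x y h
    exact hf (Set.projIcc 0 1 zero_le_one x).2 (Set.projIcc 0 1 zero_le_one y).2
      (Set.monotone_projIcc _ h)
  · intro x hx
    simp only [Set.projIcc_of_mem _ hx]

/-- For monotone nondecreasing `f, g : [0,1] → [0,1]`, the `L¹` distance between `f` and `g`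
equals the `L¹` distance between their pseudo-inverses `f̂(t) = inf {x ∈ [0,1] : f x > t}`
and `ĝ`, with the convention `inf ∅ = 1` (encoded by inserting `1` into the set). -/
theorem stmt_7 (f g : ℝ → ℝ)
    (hf : MonotoneOn f (Set.Icc 0 1)) (hg : MonotoneOn g (Set.Icc 0 1))
    (hfm : ∀ x ∈ Set.Icc (0:ℝ) 1, f x ∈ Set.Icc (0:ℝ) 1)
    (hgm : ∀ x ∈ Set.Icc (0:ℝ) 1, g x ∈ Set.Icc (0:ℝ) 1) :
    ∫ x in Set.Icc (0:ℝ) 1, |f x - g x| =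
      ∫ t in Set.Icc (0:ℝ) 1,
        |sInf (insert 1 {x ∈ Set.Icc (0:ℝ) 1 | t < f x}) -
          sInf (insert 1 {x ∈ Set.Icc (0:ℝ) 1 | t < g x})| := by
  obtain ⟨F, hFm, hF⟩ := aux_ext f hf
  obtain ⟨G, hGm, hG⟩ := aux_ext g hg
  have e1 : ∫ x in Set.Icc (0:ℝ) 1, |f x - g x| = ∫ x in Set.Icc (0:ℝ) 1, |F x - G x| := by
    apply setIntegral_congr_fun measurableSet_Icc
    intro x hx
    simp only [hF x hx, hG x hx]
  have m1 : Measurable (fun x => |F x - G x|) := (hFm.sub hGm).norm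
  have m2 : Measurable (fun t => |sInf (insert 1 {x ∈ Set.Icc (0:ℝ) 1 | t < f x}) -
          sInf (insert 1 {x ∈ Set.Icc (0:ℝ) 1 | t < g x})|) :=
    ((aux_mono f).measurable.sub (aux_mono g).measurable).norm
  rw [e1, integral_eq_lintegral_of_nonneg_ae (Filter.Eventually.of_forall fun _ => abs_nonneg _)
      m1.aestronglyMeasurable,
    integral_eq_lintegral_of_nonneg_ae (Filter.Eventually.of_forall fun _ => abs_nonneg _)
      m2.aestronglyMeasurable]
  congr 1
  set μ := volume.restrict (Set.Icc (0:ℝ) 1) with hμ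
  set S : Set (ℝ × ℝ) := symmDiff {p | p.2 < F p.1} {p | p.2 < G p.1} with hS
  have hSm : MeasurableSet S :=
    (measurableSet_lt measurable_snd (hFm.comp measurable_fst)).symmDiff
      (measurableSet_lt measurable_snd (hGm.comp measurable_fst))
  have h1 : (μ.prod μ) S = ∫⁻ x, ENNReal.ofReal |F x - G x| ∂μ := by
    rw [Measure.prod_apply hSm]
    apply lintegral_congr_ae
    filter_upwards [ae_restrict_mem measurableSet_Icc] with x hx
    exact aux_Iio (F x) (G x) (hF x hx ▸ hfm x hx) (hG x hx ▸ hgm x hx)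
  rw [← h1, Measure.prod_apply_symm hSm]
  apply lintegral_congr
  intro t
  rw [← aux_Ioi _ _ (aux_mem_s7 f t) (aux_mem_s7 g t)]
  exact measure_congr ((aux_slice f F hf hF t).symmDiff (aux_slice g G hg hG t))
end

section
/- Let K and K_j (j ∈ ℕ) be Borel subsets of [0,1], each of positive Lebesgue measure, such that λ(K_j Δ K) → 0 as j → ∞ (equivalently, 𝟙_{K_j} → 𝟙_K in L¹([0,1])). Then the transport parametrizations converge in L¹: ∫₀¹ |u_{K_j}(t) − u_K(t)| dt → 0 as j → ∞. -/
open MeasureTheory Filter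

lemma fK_mono (K : Set ℝ) (hs : K ⊆ Set.Icc 0 1) : Monotone (fK K) := by
  intro x y hxy
  unfold fK
  have hfin : volume (K ∩ Set.Icc 0 y) ≠ ⊤ :=
    ((measure_mono (Set.inter_subset_left.trans hs)).trans_lt (by simp)).ne
  gcongr

lemma fK_one (K : Set ℝ) (hs : K ⊆ Set.Icc 0 1) (hp : 0 < volume K) : fK K 1 = 1 := by
  unfold fK
  rw [Set.inter_eq_left.mpr hs]
  have hfin : volume K ≠ ⊤ := ((measure_mono hs).trans_lt (by simp)).ne
  exact div_self (ENNReal.toReal_pos hp.ne' hfin).ne'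

lemma uK_bdd (K : Set ℝ) (t : ℝ) : BddBelow {x ∈ Set.Icc (0:ℝ) 1 | t < fK K x} :=
  ⟨0, fun _ hx => hx.1.1⟩

lemma uK_mem_one (K : Set ℝ) (hs : K ⊆ Set.Icc 0 1) (hp : 0 < volume K) {t : ℝ} (ht : t < 1) :
    (1:ℝ) ∈ {x ∈ Set.Icc (0:ℝ) 1 | t < fK K x} :=
  ⟨by simp, by rw [fK_one K hs hp]; exact ht⟩

lemma uK_mono (K : Set ℝ) (hs : K ⊆ Set.Icc 0 1) (hp : 0 < volume K) :
    MonotoneOn (uK K) (Set.Iio 1) := by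
  intro s _ t ht hst
  exact csInf_le_csInf (uK_bdd K s) ⟨1, uK_mem_one K hs hp ht⟩
    (fun x hx => ⟨hx.1, hst.trans_lt hx.2⟩)

lemma uK_nonneg (K : Set ℝ) (t : ℝ) : 0 ≤ uK K t := Real.sInf_nonneg (fun _ hx => hx.1.1)

lemma uK_le_one (K : Set ℝ) (hs : K ⊆ Set.Icc 0 1) (hp : 0 < volume K) {t : ℝ} (ht : t < 1) :
    uK K t ≤ 1 := csInf_le (uK_bdd K t) (uK_mem_one K hs hp ht)

lemma meas_conv (K : ℕ → Set ℝ) (K₀ : Set ℝ)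
    (hK : ∀ j, MeasurableSet (K j)) (hKsub : ∀ j, K j ⊆ Set.Icc 0 1)
    (h₀ : MeasurableSet K₀) (h₀sub : K₀ ⊆ Set.Icc 0 1)
    (hconv : Tendsto (fun j => volume (symmDiff (K j) K₀)) atTop (nhds 0))
    (I : Set ℝ) (hI : MeasurableSet I) :
    Tendsto (fun j => (volume (K j ∩ I)).toReal) atTop (nhds (volume (K₀ ∩ I)).toReal) := by
  have hf : ∀ A : Set ℝ, A ⊆ Set.Icc 0 1 → volume A ≠ ⊤ := fun A hA =>
    ((measure_mono hA).trans_lt (by simp)).ne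
  have h1 : Tendsto (fun j => (volume (symmDiff (K j) K₀)).toReal) atTop (nhds 0) := by
    simpa [Function.comp_def] using (ENNReal.tendsto_toReal ENNReal.zero_ne_top).comp hconv
  rw [tendsto_iff_dist_tendsto_zero]
  refine squeeze_zero (fun _ => dist_nonneg) (fun j => ?_) h1
  rw [Real.dist_eq]
  have hsd : symmDiff (K j) K₀ ⊆ Set.Icc 0 1 := by
    rintro x (hx | hx)
    · exact hKsub j hx.1
    · exact h₀sub hx.1
  have h2 := abs_measureReal_sub_le_measureReal_symmDiff' (μ := volume)
    ((hK j).inter hI).nullMeasurableSet (h₀.inter hI).nullMeasurableSet (hf _ (Set.inter_subset_left.trans (hKsub j)))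
    (hf _ (Set.inter_subset_left.trans h₀sub))
  refine h2.trans (ENNReal.toReal_mono (hf _ hsd) (measure_mono ?_))
  rintro x (⟨⟨a, b⟩, c⟩ | ⟨⟨a, b⟩, c⟩)
  · exact Or.inl ⟨a, fun h => c ⟨h, b⟩⟩
  · exact Or.inr ⟨a, fun h => c ⟨h, b⟩⟩

lemma uK_tendsto (K : ℕ → Set ℝ) (K₀ : Set ℝ)
    (hKsub : ∀ j, K j ⊆ Set.Icc 0 1) (hKpos : ∀ j, 0 < volume (K j))
    (h₀sub : K₀ ⊆ Set.Icc 0 1) (h₀pos : 0 < volume K₀)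
    (hf : ∀ x, Tendsto (fun j => fK (K j) x) atTop (nhds (fK K₀ x)))
    {t : ℝ} (ht : t < 1) (hc : ContinuousWithinAt (uK K₀) (Set.Iio 1) t) :
    Tendsto (fun j => uK (K j) t) atTop (nhds (uK K₀ t)) := by
  have hc' : ContinuousAt (uK K₀) t := hc.continuousAt (Iio_mem_nhds ht)
  rw [tendsto_order]
  constructor
  · intro a ha
    obtain ⟨x, hax, hx⟩ := exists_between ha
    have h1 : ∀ᶠ s in nhdsWithin t (Set.Iio t), x < uK K₀ s :=
      (hc'.eventually (lt_mem_nhds hx)).filter_mono nhdsWithin_le_nhds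
    obtain ⟨s, hs, hst⟩ := (h1.and self_mem_nhdsWithin).exists
    by_cases hx0 : 0 ≤ x
    · have hx1 : x ≤ 1 := hx.le.trans (uK_le_one K₀ h₀sub h₀pos ht)
      have h2 : fK K₀ x ≤ s := by
        by_contra! h
        exact absurd (csInf_le (uK_bdd K₀ s) ⟨⟨hx0, hx1⟩, h⟩) (not_le.mpr hs)
      filter_upwards [(hf x).eventually (gt_mem_nhds (h2.trans_lt hst))] with j hj
      refine hax.trans_le (le_csInf ⟨1, uK_mem_one (K j) (hKsub j) (hKpos j) ht⟩ fun y hy => ?_)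
      by_contra! h
      have := fK_mono (K j) (hKsub j) h.le
      linarith [hy.2]
    · exact Eventually.of_forall fun j => by linarith [uK_nonneg (K j) t]
  · intro b hb
    obtain ⟨x, hx, hxb⟩ := exists_lt_of_csInf_lt ⟨1, uK_mem_one K₀ h₀sub h₀pos ht⟩ hb
    filter_upwards [(hf x).eventually (lt_mem_nhds hx.2)] with j hj
    exact (csInf_le (uK_bdd (K j) t) ⟨hx.1, hj⟩).trans_lt hxb

/-- If `K j` and `K₀` are Borel subsets of `[0,1]` of positive Lebesgue measure, and
`λ(K j Δ K₀) → 0`, then the transport parametrizations converge in `L¹`: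
`∫₀¹ |u_{K j} − u_{K₀}| → 0`. -/
theorem stmt_8 (K : ℕ → Set ℝ) (K₀ : Set ℝ)
    (hK : ∀ j, MeasurableSet (K j)) (hKsub : ∀ j, K j ⊆ Set.Icc 0 1)
    (hKpos : ∀ j, 0 < volume (K j))
    (h₀ : MeasurableSet K₀) (h₀sub : K₀ ⊆ Set.Icc 0 1) (h₀pos : 0 < volume K₀)
    (hconv : Tendsto (fun j => volume (symmDiff (K j) K₀)) atTop (nhds 0)) :
    Tendsto (fun j => ∫ t in Set.Icc (0:ℝ) 1, |uK (K j) t - uK K₀ t|)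
      atTop (nhds 0) := by
  have hf : ∀ x, Tendsto (fun j => fK (K j) x) atTop (nhds (fK K₀ x)) := by
    intro x
    have hm := meas_conv K K₀ hK hKsub h₀ h₀sub hconv
    have h2 := hm Set.univ MeasurableSet.univ
    simp only [Set.inter_univ] at h2
    have hfin : volume K₀ ≠ ⊤ := ((measure_mono h₀sub).trans_lt (by simp)).ne
    exact (hm (Set.Icc 0 x) measurableSet_Icc).div h2 (ENNReal.toReal_pos h₀pos.ne' hfin).ne'
  simp only [integral_Icc_eq_integral_Ico]
  have hmeas : ∀ A : Set ℝ, A ⊆ Set.Icc 0 1 → 0 < volume A →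
      AEMeasurable (uK A) (volume.restrict (Set.Ico (0:ℝ) 1)) := fun A hA hp =>
    aemeasurable_restrict_of_monotoneOn measurableSet_Ico
      ((uK_mono A hA hp).mono (fun _ h => h.2))
  have hcount := (uK_mono K₀ h₀sub h₀pos).countable_not_continuousWithinAt
  have key := tendsto_integral_of_dominated_convergence
    (μ := volume.restrict (Set.Ico (0:ℝ) 1))
    (F := fun j t => |uK (K j) t - uK K₀ t|) (f := fun _ => (0:ℝ)) (fun _ => (1:ℝ))
    (fun j => (((hmeas _ (hKsub j) (hKpos j)).sub
      (hmeas _ h₀sub h₀pos)).aestronglyMeasurable).norm)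
    (integrable_const _) ?_ ?_
  · simpa using key
  · intro j
    filter_upwards [ae_restrict_mem measurableSet_Ico] with t ht
    rw [Real.norm_eq_abs, abs_abs, abs_le]
    have a1 := uK_nonneg (K j) t
    have a2 := uK_nonneg K₀ t
    have a3 := uK_le_one (K j) (hKsub j) (hKpos j) ht.2
    have a4 := uK_le_one K₀ h₀sub h₀pos ht.2
    constructor <;> linarith
  · filter_upwards [ae_restrict_mem measurableSet_Ico,
      ae_restrict_of_ae (hcount.ae_notMem volume)] with t ht htc
    have hc : ContinuousWithinAt (uK K₀) (Set.Iio 1) t := by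
      by_contra h
      exact htc ⟨ht.2, h⟩
    have := uK_tendsto K K₀ hKsub hKpos h₀sub h₀pos hf ht.2 hc
    simpa using (this.sub_const (uK K₀ t)).abs
end

section
/- Let X be a complete metric space and c ≥ 1, and assume X is piecewise quasiconvex with constant c: for all x, y ∈ X and all ε > 0 there exist m ∈ ℕ, points x_1, y_1, …, x_m, y_m ∈ X with d(x,x_1) + d(y_m,y) + Σ_{i=1}^{m−1} d(x_{i+1}, y_i) < ε, and Lipschitz curves θ_1, …, θ_m : [0,1] → X with θ_i(0) = x_i, θ_i(1) = y_i and Σ_{i=1}^m ℓ(θ_i) ≤ c·d(x,y). Then X is quasiconvex: there exists c' ≥ 1 such that for all x, y ∈ X there is a Lipschitz curve θ : [0,1] → X with θ(0) = x, θ(1) = y and ℓ(θ) ≤ c'·d(x,y). -/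
/-- Partial curves (as graphs) which are 1-Lipschitz and slow across gaps. -/
def PC {X : Type*} [MetricSpace X] (lam : ℝ) (G : Set (ℝ × X)) : Prop :=
  (∀ a ∈ G, ∀ b ∈ G, dist a.2 b.2 ≤ |a.1 - b.1|) ∧
  (∀ a ∈ G, ∀ b ∈ G, ∀ u v : ℝ, a.1 ≤ u → u < v → v ≤ b.1 →
    (∀ z ∈ G, z.1 ≤ u ∨ v ≤ z.1) → dist a.2 b.2 ≤ (u - a.1) + lam * (v - u) + (b.1 - v))

/-- Fillability of the pair `p, q` in time `τ`. -/
def Fil {X : Type*} [MetricSpace X] (lam : ℝ) (p q : X) (τ : ℝ) : Prop :=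
  ∀ a : ℝ, ∃ F : Set (ℝ × X), PC lam F ∧ (∀ z ∈ F, a ≤ z.1 ∧ z.1 ≤ a + τ) ∧
    (a, p) ∈ F ∧ (a + τ, q) ∈ F

theorem PC.concat {X : Type*} [MetricSpace X] {lam : ℝ} {F G : Set (ℝ × X)} {r : ℝ} {w : X}
    (hF : PC lam F) (hG : PC lam G) (hF1 : ∀ z ∈ F, z.1 ≤ r) (hG1 : ∀ z ∈ G, r ≤ z.1)
    (hFr : (r, w) ∈ F) (hGr : (r, w) ∈ G) : PC lam (F ∪ G) := by
  have key : ∀ a ∈ F, ∀ b ∈ G, dist a.2 b.2 ≤ b.1 - a.1 := by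
    intro a ha b hb
    have h1 := hF.1 a ha _ hFr
    have h2 := hG.1 _ hGr b hb
    have := dist_triangle a.2 w b.2
    have h3 := hF1 a ha
    have h4 := hG1 b hb
    simp only at h1 h2
    rw [abs_of_nonpos (by linarith)] at h1 h2
    linarith
  refine ⟨?_, ?_⟩
  · rintro a (ha | ha) b (hb | hb)
    · exact hF.1 a ha b hb
    · refine (key a ha b hb).trans ?_
      rw [abs_sub_comm]; exact le_abs_self _
    · rw [dist_comm]; exact (key b hb a ha).trans (le_abs_self _)
    · exact hG.1 a ha b hb
  · rintro a ha b hb u v hu huv hv hgap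
    have gF : ∀ z ∈ F, z.1 ≤ u ∨ v ≤ z.1 := fun z hz => hgap z (Or.inl hz)
    have gG : ∀ z ∈ G, z.1 ≤ u ∨ v ≤ z.1 := fun z hz => hgap z (Or.inr hz)
    rcases ha with ha | ha <;> rcases hb with hb | hb
    · exact hF.2 a ha b hb u v hu huv hv gF
    · have tri := dist_triangle a.2 w b.2
      have h3 := hF1 a ha
      have h4 := hG1 b hb
      rcases gF _ hFr with h | h
      · simp only at h
        have h1 := hF.1 a ha _ hFr
        have h2 := hG.2 _ hGr b hb u v h huv hv gG
        simp only at h1 h2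
        rw [abs_of_nonpos (by linarith)] at h1
        linarith
      · simp only at h
        have h1 := hF.2 a ha _ hFr u v hu huv h gF
        have h2 := hG.1 _ hGr b hb
        simp only at h1 h2
        rw [abs_of_nonpos (by linarith)] at h2
        linarith
    · have h3 := hG1 a ha
      have h4 := hF1 b hb
      linarith
    · exact hG.2 a ha b hb u v hu huv hv gG

theorem PC.pair {X : Type*} [MetricSpace X] {lam : ℝ} (h1 : lam ≤ 1)
    {s t : ℝ} {p q : X} (hst : s ≤ t) (hd : dist p q ≤ lam * (t - s)) :
    PC lam ({(s, p), (t, q)} : Set (ℝ × X)) := by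
  have hd' : dist p q ≤ t - s := by nlinarith
  refine ⟨?_, ?_⟩
  · rintro a (rfl | rfl) b (rfl | rfl)
    · simp
    · simp only; rw [abs_sub_comm, abs_of_nonneg (by linarith)]; exact hd'
    · simp only; rw [abs_of_nonneg (by linarith), dist_comm]; exact hd'
    · simp
  · rintro a (rfl | rfl) b (rfl | rfl) u v hu huv hv -
    · simp only at *; linarith
    · simp only at *; nlinarith
    · simp only at *; linarith
    · simp only at *; linarith

theorem PC.restrict {X : Type*} [MetricSpace X] {lam : ℝ} {G : Set (ℝ × X)} (hG : PC lam G)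
    (s t : ℝ) : PC lam {z ∈ G | s ≤ z.1 ∧ z.1 ≤ t} := by
  refine ⟨fun a ha b hb => hG.1 a ha.1 b hb.1, ?_⟩
  intro a ha b hb u v hu huv hv hgap
  refine hG.2 a ha.1 b hb.1 u v hu huv hv fun z hz => ?_
  by_contra! hcon
  rcases hgap z ⟨hz, by linarith [ha.2.1], by linarith [hb.2.2]⟩ with h | h <;> linarith

theorem Fil.gap {X : Type*} [MetricSpace X] {lam : ℝ} (h1 : lam ≤ 1)
    {p q : X} {τ : ℝ} (hτ : 0 ≤ τ) (hd : dist p q ≤ lam * τ) : Fil lam p q τ := by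
  intro a
  refine ⟨{(a, p), (a + τ, q)}, PC.pair h1 (by linarith) (by simpa using hd), ?_, by simp, by simp⟩
  rintro z (rfl | rfl) <;> simp [hτ]

theorem Fil.trans {X : Type*} [MetricSpace X] {lam : ℝ} {p q r : X} {τ σ : ℝ}
    (hτ : Fil lam p q τ) (hσ : Fil lam q r σ) : Fil lam p r (τ + σ) := by
  intro a
  obtain ⟨F, hF, hF1, hF2, hF3⟩ := hτ a
  obtain ⟨G, hG, hG1, hG2, hG3⟩ := hσ (a + τ)
  have e1 := hF1 _ hF3
  have e2 := hG1 _ hG3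
  simp only at e1 e2
  refine ⟨F ∪ G, hF.concat hG (fun z hz => (hF1 z hz).2) (fun z hz => (hG1 z hz).1) hF3 hG2, ?_,
    Or.inl hF2, Or.inr (by rwa [← add_assoc])⟩
  rintro z (hz | hz)
  · have := hF1 z hz; constructor <;> linarith
  · have := hG1 z hz; constructor <;> linarith

theorem lip_var {X : Type*} [MetricSpace X] {θ : ℝ → X} {L : NNReal} {s t : ℝ} {S : Set ℝ}
    (hθ : LipschitzOnWith L θ S) (hst : s ≤ t) (hS : Set.Icc s t ⊆ S) :
    eVariationOn θ (Set.Icc s t) ≤ ENNReal.ofReal (L * (t - s)) := by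
  have h1 := (hθ.mono hS).comp_eVariationOn_le (g := (id : ℝ → ℝ)) (s := Set.Icc s t)
    (fun x hx => hx)
  have h2 : eVariationOn (id : ℝ → ℝ) (Set.Icc s t) ≤ ENNReal.ofReal (t - s) := by
    simp
  rw [ENNReal.ofReal_mul L.coe_nonneg, ENNReal.ofReal_coe_nnreal]
  exact h1.trans (by gcongr)

theorem Fil.curve {X : Type*} [MetricSpace X] {lam : ℝ} {θ : ℝ → X} {L : NNReal}
    (hθ : LipschitzOnWith L θ (Set.Icc 0 1)) :
    Fil lam (θ 0) (θ 1) (eVariationOn θ (Set.Icc 0 1)).toReal := by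
  intro a
  set V : ℝ → ℝ := fun t => (eVariationOn θ (Set.Icc 0 t)).toReal with hV
  have fin : ∀ s t : ℝ, s ≤ t → 0 ≤ s → t ≤ 1 → eVariationOn θ (Set.Icc s t) ≠ ⊤ := by
    intro s t hst hs ht
    exact ne_top_of_le_ne_top ENNReal.ofReal_ne_top
      (lip_var hθ hst (Set.Icc_subset_Icc hs ht))
  have add : ∀ s t : ℝ, 0 ≤ s → s ≤ t → t ≤ 1 →
      V t = V s + (eVariationOn θ (Set.Icc s t)).toReal := by
    intro s t hs hst ht
    have := eVariationOn.Icc_add_Icc θ (s := Set.univ) hs hst (Set.mem_univ _)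
    simp only [Set.univ_inter] at this
    rw [hV]; simp only
    rw [← this, ENNReal.toReal_add (fin _ _ hs le_rfl (hst.trans ht)) (fin _ _ hst hs ht)]
  have V0 : V 0 = 0 := by simp [hV, eVariationOn.subsingleton]
  have mono : ∀ s t : ℝ, 0 ≤ s → s ≤ t → t ≤ 1 → V s ≤ V t := by
    intro s t hs hst ht
    rw [add s t hs hst ht]
    linarith [ENNReal.toReal_nonneg (a := eVariationOn θ (Set.Icc s t))]
  have dst : ∀ s t : ℝ, 0 ≤ s → s ≤ t → t ≤ 1 → dist (θ s) (θ t) ≤ V t - V s := by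
    intro s t hs hst ht
    rw [add s t hs hst ht, add_sub_cancel_left, dist_edist]
    exact ENNReal.toReal_mono (fin s t hst hs ht)
      (eVariationOn.edist_le θ (Set.left_mem_Icc.2 hst) (Set.right_mem_Icc.2 hst))
  have lipV : ∀ s t : ℝ, 0 ≤ s → s ≤ t → t ≤ 1 → V t - V s ≤ L * (t - s) := by
    intro s t hs hst ht
    rw [add s t hs hst ht, add_sub_cancel_left]
    refine ENNReal.toReal_le_of_le_ofReal (mul_nonneg L.2 (by linarith))
      (lip_var hθ hst (Set.Icc_subset_Icc hs ht))
  have contV : ContinuousOn V (Set.Icc 0 1) := by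
    refine (LipschitzOnWith.of_dist_le_mul (K := L) ?_).continuousOn
    intro s hs t ht
    rw [Real.dist_eq, Real.dist_eq]
    rcases le_total s t with h | h
    · have h1 := mono s t hs.1 h ht.2
      rw [abs_sub_comm, abs_of_nonneg (by linarith), abs_sub_comm, abs_of_nonneg (by linarith)]
      exact lipV s t hs.1 h ht.2
    · have h1 := mono t s ht.1 h hs.2
      rw [abs_of_nonneg (by linarith), abs_of_nonneg (by linarith)]
      exact lipV t s ht.1 h hs.2
  refine ⟨(fun t => (a + V t, θ t)) '' Set.Icc 0 1, ⟨?_, ?_⟩, ?_, ⟨0, by simp, by simp [V0]⟩,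
    ⟨1, by simp, rfl⟩⟩
  · rintro _ ⟨s, hs, rfl⟩ _ ⟨t, ht, rfl⟩
    simp only
    rw [add_sub_add_left_eq_sub]
    rcases le_total s t with h | h
    · rw [abs_sub_comm]
      exact (dst s t hs.1 h ht.2).trans (le_abs_self _)
    · rw [dist_comm]
      exact (dst t s ht.1 h hs.2).trans (le_abs_self _)
  · rintro _ ⟨s, hs, rfl⟩ _ ⟨t, ht, rfl⟩ u v hu huv hv hgap
    exfalso
    simp only at hu hv
    have h0 := mono 0 s le_rfl hs.1 hs.2
    have h1 := mono t 1 ht.1 ht.2 le_rfl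
    obtain ⟨w, hw, hw'⟩ := intermediate_value_Icc (zero_le_one) contV
      (show (u + v) / 2 - a ∈ Set.Icc (V 0) (V 1) from ⟨by linarith, by linarith⟩)
    rcases hgap _ ⟨w, hw, rfl⟩ with h | h <;> simp only at h <;> linarith
  · rintro _ ⟨s, hs, rfl⟩
    have h0 := mono 0 s le_rfl hs.1 hs.2
    have h1 := mono s 1 hs.1 hs.2 le_rfl
    simp only at *
    constructor
    · linarith
    · change a + V s ≤ a + V 1
      linarith

theorem PC.closure {X : Type*} [MetricSpace X] {lam : ℝ} {G : Set (ℝ × X)} (hG : PC lam G) :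
    PC lam (closure G) := by
  refine ⟨?_, ?_⟩
  · intro a ha b hb
    obtain ⟨f, hf, hfa⟩ := mem_closure_iff_seq_limit.1 ha
    obtain ⟨g, hg, hgb⟩ := mem_closure_iff_seq_limit.1 hb
    have hfa1 := (continuous_fst.tendsto a).comp hfa
    have hfa2 := (continuous_snd.tendsto a).comp hfa
    have hgb1 := (continuous_fst.tendsto b).comp hgb
    have hgb2 := (continuous_snd.tendsto b).comp hgb
    exact le_of_tendsto_of_tendsto' (hfa2.dist hgb2) (hfa1.sub hgb1).abs
      (fun n => hG.1 _ (hf n) _ (hg n))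
  · intro a ha b hb u v hu huv hv hgap
    obtain ⟨f, hf, hfa⟩ := mem_closure_iff_seq_limit.1 ha
    obtain ⟨g, hg, hgb⟩ := mem_closure_iff_seq_limit.1 hb
    have hfa1 := (continuous_fst.tendsto a).comp hfa
    have hfa2 := (continuous_snd.tendsto a).comp hfa
    have hgb1 := (continuous_fst.tendsto b).comp hgb
    have hgb2 := (continuous_snd.tendsto b).comp hgb
    have e1 := hfa1.eventually_lt_const (show a.1 < v by linarith)
    have e2 := hgb1.eventually_const_lt (show u < b.1 by linarith)
    refine le_of_tendsto_of_tendsto (hfa2.dist hgb2)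
      (((tendsto_const_nhds.sub hfa1).add tendsto_const_nhds).add (hgb1.sub tendsto_const_nhds)) ?_
    filter_upwards [e1, e2] with n h1 h2
    simp only [Function.comp] at h1 h2
    refine hG.2 _ (hf n) _ (hg n) u v ?_ huv ?_ (fun z hz => hgap z (subset_closure hz))
    · exact (hgap _ (subset_closure (hf n))).resolve_right (by linarith)
    · exact (hgap _ (subset_closure (hg n))).resolve_left (by linarith)

theorem PC.proj_closed {X : Type*} [MetricSpace X] [CompleteSpace X] {lam : ℝ}
    {G : Set (ℝ × X)} (hG : PC lam G) (hc : IsClosed G) : IsClosed (Prod.fst '' G) := by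
  refine isClosed_of_closure_subset fun t ht => ?_
  obtain ⟨f, hf, hft⟩ := mem_closure_iff_seq_limit.1 ht
  choose g hg hgf using hf
  have hcs : CauchySeq (fun n => (g n).2) := by
    rw [Metric.cauchySeq_iff]
    intro ε hε
    obtain ⟨N, hN⟩ := Metric.cauchySeq_iff.1 hft.cauchySeq ε hε
    refine ⟨N, fun m hm n hn => lt_of_le_of_lt (hG.1 _ (hg m) _ (hg n)) ?_⟩
    rw [hgf, hgf]
    exact hN m hm n hn
  obtain ⟨p, hp⟩ := cauchySeq_tendsto_of_complete hcs
  have hlim : Filter.Tendsto g Filter.atTop (nhds (t, p)) := by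
    have h1 : Filter.Tendsto (fun n => (g n).1) Filter.atTop (nhds t) := by
      simpa only [hgf] using hft
    exact h1.prodMk_nhds hp
  exact ⟨(t, p), hc.mem_of_tendsto hlim (Filter.Eventually.of_forall hg), rfl⟩

theorem PC.sUnion {X : Type*} [MetricSpace X] {lam : ℝ} {C : Set (Set (ℝ × X))}
    (hC : ∀ G ∈ C, PC lam G) (hch : IsChain (· ⊆ ·) C) : PC lam (⋃₀ C) := by
  have two : ∀ a ∈ ⋃₀ C, ∀ b ∈ ⋃₀ C, ∃ G ∈ C, a ∈ G ∧ b ∈ G := by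
    rintro a ⟨G, hG, ha⟩ b ⟨H, hH, hb⟩
    rcases hch.total hG hH with h | h
    · exact ⟨H, hH, h ha, hb⟩
    · exact ⟨G, hG, ha, h hb⟩
  refine ⟨?_, ?_⟩
  · intro a ha b hb
    obtain ⟨G, hG, ha, hb⟩ := two a ha b hb
    exact (hC G hG).1 a ha b hb
  · intro a ha b hb u v hu huv hv hgap
    obtain ⟨G, hG, ha, hb⟩ := two a ha b hb
    exact (hC G hG).2 a ha b hb u v hu huv hv fun z hz => hgap z ⟨G, hG, hz⟩

/-- If gaps can be filled strictly, a full curve exists. -/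
theorem exists_full {X : Type*} [MetricSpace X] [CompleteSpace X] {lam : ℝ} (h1 : lam ≤ 1)
    (hfill : ∀ (p q : X) (T : ℝ), 0 < T → dist p q ≤ lam * T →
      ∃ τ, 0 < τ ∧ τ < T ∧ Fil lam p q τ) (h0 : 0 ≤ lam)
    (x y : X) (T : ℝ) (hT : 0 ≤ T) (hxy : dist x y ≤ lam * T) :
    ∃ G : Set (ℝ × X), PC lam G ∧ (0, x) ∈ G ∧ (T, y) ∈ G ∧
      ∀ t ∈ Set.Icc 0 T, ∃ p, (t, p) ∈ G := by
  obtain ⟨G, hsub, hmax⟩ := zorn_subset_nonempty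
    {G : Set (ℝ × X) | PC lam G ∧ ∀ z ∈ G, 0 ≤ z.1 ∧ z.1 ≤ T}
    (fun C hC hch _ => ⟨⋃₀ C, ⟨PC.sUnion (fun G hG => (hC hG).1) hch, by
      rintro z ⟨G, hG, hz⟩; exact (hC hG).2 z hz⟩, fun s hs => Set.subset_sUnion_of_mem hs⟩)
    {(0, x), (T, y)} ⟨PC.pair h1 hT (by simpa using hxy), by
      rintro z (rfl | rfl) <;> simp [hT]⟩
  have hG := hmax.prop.1
  have hb := hmax.prop.2
  have hmx : ∀ H : Set (ℝ × X), PC lam H → (∀ z ∈ H, 0 ≤ z.1 ∧ z.1 ≤ T) → G ⊆ H → H ⊆ G :=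
    fun H h h' hs => hmax.le_of_ge ⟨h, h'⟩ hs
  have hx : (0, x) ∈ G := hsub (by simp)
  have hy : (T, y) ∈ G := hsub (by simp)
  refine ⟨G, hG, hx, hy, ?_⟩
  have hcl : IsClosed G := by
    refine isClosed_of_closure_subset (hmx _ hG.closure ?_ subset_closure)
    have : closure G ⊆ {z : ℝ × X | 0 ≤ z.1 ∧ z.1 ≤ T} := by
      refine closure_minimal hb ?_
      exact (isClosed_le continuous_const continuous_fst).inter
        (isClosed_le continuous_fst continuous_const)
    exact this
  have hK := hG.proj_closed hcl
  intro t ht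
  by_contra hno
  have hA : IsCompact (Prod.fst '' G ∩ Set.Icc 0 t) := isCompact_Icc.inter_left hK
  have hB : IsCompact (Prod.fst '' G ∩ Set.Icc t T) := isCompact_Icc.inter_left hK
  obtain ⟨a, ⟨⟨⟨a', p⟩, hap, rfl⟩, ha⟩, hamax⟩ := hA.exists_isGreatest ⟨0, ⟨_, hx, rfl⟩, le_rfl, ht.1⟩
  obtain ⟨b, ⟨⟨⟨b', q⟩, hbq, rfl⟩, hbb⟩, hbmin⟩ := hB.exists_isLeast ⟨T, ⟨_, hy, rfl⟩, ht.2, le_rfl⟩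
  simp only at ha hbb hamax hbmin
  have hat : a' < t := lt_of_le_of_ne ha.2 (by rintro rfl; exact hno ⟨p, hap⟩)
  have htb : t < b' := lt_of_le_of_ne hbb.1 (by rintro rfl; exact hno ⟨q, hbq⟩)
  have hgap : ∀ z ∈ G, z.1 ≤ a' ∨ b' ≤ z.1 := by
    intro z hz
    rcases le_total z.1 t with h | h
    · exact Or.inl (hamax ⟨⟨z, hz, rfl⟩, (hb z hz).1, h⟩)
    · exact Or.inr (hbmin ⟨⟨z, hz, rfl⟩, h, (hb z hz).2⟩)
  have hd := hG.2 _ hap _ hbq a' b' le_rfl (by linarith) le_rfl hgap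
  simp only [sub_self, zero_add, add_zero] at hd
  obtain ⟨τ, hτ0, hτ, hfil⟩ := hfill p q (b' - a') (by linarith) hd
  obtain ⟨F, hF, hF1, hF2, hF3⟩ := hfil a'
  have hP : PC lam ({(a' + τ, q), (b', q)} : Set (ℝ × X)) :=
    PC.pair h1 (by linarith) (by rw [dist_self]; exact mul_nonneg h0 (by linarith))
  have c1 := (hG.restrict 0 a').concat hF (fun z hz => hz.2.2) (fun z hz => (hF1 z hz).1)
    ⟨hap, ha.1, le_rfl⟩ hF2
  have c2 := c1.concat hP (r := a' + τ) (w := q)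
    (by
      rintro z (hz | hz)
      · linarith [hz.2.2]
      · exact (hF1 z hz).2)
    (by rintro z (rfl | rfl) <;> simp only <;> linarith) (Or.inr hF3) (by simp)
  have c3 := c2.concat (hG.restrict b' T) (r := b') (w := q)
    (by
      rintro z ((hz | hz) | (rfl | rfl))
      · linarith [hz.2.2]
      · linarith [(hF1 z hz).2]
      · simp only; linarith
      · exact le_rfl)
    (fun z hz => hz.2.1) (Or.inr (by simp)) ⟨hbq, le_rfl, hbb.2⟩
  have hin := hmx _ c3
    (by
      rintro z (((hz | hz) | (rfl | rfl)) | hz)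
      · exact hb z hz.1
      · have := hF1 z hz
        constructor <;> linarith [ha.1, hbb.2]
      · constructor <;> simp only <;> linarith [ha.1, hbb.2]
      · exact hb _ hbq
      · exact hb z hz.1)
    (by
      intro z hz
      rcases hgap z hz with h | h
      · exact Or.inl (Or.inl (Or.inl ⟨hz, (hb z hz).1, h⟩))
      · exact Or.inr ⟨hz, h, (hb z hz).2⟩)
  have hnew : (a' + τ, q) ∈ G := hin (Or.inl (Or.inl (Or.inr hF3)))
  rcases hgap _ hnew with h | h <;> simp only at h <;> linarith


/-- A complete piecewise quasiconvex metric space (with constant `c`) is quasiconvex: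
there is `c' ≥ 1` such that any two points `x, y` are joined by a Lipschitz curve of
length at most `c' · d(x,y)`. -/
theorem stmt_13 {X : Type*} [MetricSpace X] [CompleteSpace X]
    (c : ℝ) (hc : 1 ≤ c)
    (hpqc : ∀ x y : X, ∀ ε > (0:ℝ),
      ∃ (m : ℕ) (_ : 1 ≤ m) (xs ys : ℕ → X) (θ : ℕ → ℝ → X),
        dist x (xs 1) + dist (ys m) y
            + ∑ i ∈ Finset.Ico 1 m, dist (xs (i + 1)) (ys i) < ε ∧
        (∀ i ∈ Finset.Icc 1 m,
          (∃ L, LipschitzOnWith L (θ i) (Set.Icc 0 1)) ∧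
            θ i 0 = xs i ∧ θ i 1 = ys i) ∧
        ∑ i ∈ Finset.Icc 1 m, eVariationOn (θ i) (Set.Icc 0 1)
            ≤ ENNReal.ofReal (c * dist x y)) :
    ∃ c' : ℝ, 1 ≤ c' ∧ ∀ x y : X, ∃ θ : ℝ → X,
      (∃ L, LipschitzOnWith L θ (Set.Icc 0 1)) ∧ θ 0 = x ∧ θ 1 = y ∧
        eVariationOn θ (Set.Icc 0 1) ≤ ENNReal.ofReal (c' * dist x y) := by
  have hc0 : 0 < c := by linarith
  set lam : ℝ := (2 * c)⁻¹ with hlam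
  have h0 : 0 < lam := by positivity
  have h1 : lam ≤ 1 := inv_le_one_of_one_le₀ (by linarith)
  have hlc : lam * (2 * c) = 1 := inv_mul_cancel₀ (by positivity)
  have gapF : ∀ p q : X, Fil lam p q (2 * c * dist p q) := fun p q =>
    Fil.gap h1 (by positivity) (by rw [← mul_assoc, hlc, one_mul])
  have fillable : ∀ (p q : X) (T : ℝ), 0 < T → dist p q ≤ lam * T →
      ∃ τ, 0 < τ ∧ τ < T ∧ Fil lam p q τ := by
    intro p q T hT hd
    rcases eq_or_ne p q with rfl | hpq
    · exact ⟨T / 2, by linarith, by linarith, Fil.gap h1 (by linarith) (by simp; positivity)⟩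
    have hdp : 0 < dist p q := dist_pos.2 hpq
    obtain ⟨m, hm, xs, ys, θ, hgap, hθ, hlen⟩ := hpqc p q (dist p q / 2) (by positivity)
    have ind : ∀ k, 1 ≤ k → k ≤ m → Fil lam p (ys k)
        (2 * c * (dist p (xs 1) + ∑ i ∈ Finset.Ico 1 k, dist (xs (i + 1)) (ys i))
          + ∑ i ∈ Finset.Icc 1 k, (eVariationOn (θ i) (Set.Icc 0 1)).toReal) := by
      intro k hk
      induction k, hk using Nat.le_induction with
      | base =>
        intro hm
        obtain ⟨⟨L, hL⟩, e0, e1⟩ := hθ 1 (Finset.mem_Icc.2 ⟨le_rfl, hm⟩)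
        have := (gapF p (xs 1)).trans (e0 ▸ e1 ▸ Fil.curve (lam := lam) hL)
        simpa using this
      | succ k hk ih =>
        intro hkm
        obtain ⟨⟨L, hL⟩, e0, e1⟩ := hθ (k + 1) (Finset.mem_Icc.2 ⟨by omega, hkm⟩)
        have := ((ih (by omega)).trans (gapF (ys k) (xs (k + 1)))).trans
          (e0 ▸ e1 ▸ Fil.curve (lam := lam) hL)
        rw [Finset.sum_Ico_succ_top hk, Finset.sum_Icc_succ_top (by omega)]
        convert this using 1
        rw [dist_comm (ys k)]
        ring
    have htot := (ind m hm le_rfl).trans (gapF (ys m) q)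
    have hsum : ∑ i ∈ Finset.Icc 1 m, (eVariationOn (θ i) (Set.Icc 0 1)).toReal
        ≤ c * dist p q := by
      have hne : ∀ i ∈ Finset.Icc 1 m, eVariationOn (θ i) (Set.Icc 0 1) ≠ ⊤ := fun i hi =>
        ne_top_of_le_ne_top ENNReal.ofReal_ne_top
          ((Finset.single_le_sum (f := fun i => eVariationOn (θ i) (Set.Icc 0 1))
            (fun _ _ => zero_le) hi).trans hlen)
      rw [← ENNReal.toReal_sum hne]
      exact ENNReal.toReal_le_of_le_ofReal (by positivity) hlen
    refine ⟨_, ?_, ?_, htot⟩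
    · obtain ⟨F, hF, hF1, hF2, hF3⟩ := htot 0
      have e1 := hF.1 _ hF2 _ hF3
      have e2 := (hF1 _ hF3).1
      simp only at e1 e2
      rw [zero_add] at e1 e2
      rw [zero_sub, abs_neg, abs_of_nonneg e2] at e1
      linarith
    · have hT' : 2 * c * dist p q ≤ T := by
        calc 2 * c * dist p q ≤ 2 * c * (lam * T) := by gcongr
          _ = (lam * (2 * c)) * T := by ring
          _ = T := by rw [hlc, one_mul]
      have := mul_lt_mul_of_pos_left hgap (show 0 < 2 * c by linarith)
      linarith
  refine ⟨2 * c, by linarith, fun x y => ?_⟩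
  have hT : 0 ≤ 2 * c * dist x y := by positivity
  obtain ⟨G, hG, hx, hy, hfull⟩ := exists_full h1 fillable h0.le x y (2 * c * dist x y) hT
    (by rw [← mul_assoc, hlc, one_mul])
  set T := 2 * c * dist x y with hTd
  have hex : ∀ t : ℝ, ∃ p : X, t ∈ Set.Icc (0:ℝ) 1 → (T * t, p) ∈ G := by
    intro t
    by_cases ht : t ∈ Set.Icc (0:ℝ) 1
    · obtain ⟨p, hp⟩ := hfull (T * t) ⟨mul_nonneg hT ht.1, mul_le_of_le_one_right hT ht.2⟩
      exact ⟨p, fun _ => hp⟩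
    · exact ⟨x, fun h => absurd h ht⟩
  choose f hf using hex
  have uniq : ∀ t p q, (t, p) ∈ G → (t, q) ∈ G → p = q := by
    intro t p q hp hq
    have := hG.1 _ hp _ hq
    simp only [sub_self, abs_zero] at this
    exact dist_le_zero.1 this
  have hlip : LipschitzOnWith ⟨T, hT⟩ f (Set.Icc 0 1) := by
    refine LipschitzOnWith.of_dist_le_mul fun s hs t ht => ?_
    have := hG.1 _ (hf s hs) _ (hf t ht)
    simp only at this
    rw [← mul_sub, abs_mul, abs_of_nonneg hT] at this
    exact this
  refine ⟨f, ⟨_, hlip⟩, ?_, ?_, ?_⟩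
  · exact uniq _ _ _ (hf 0 (by simp)) (by simpa using hx)
  · exact uniq _ _ _ (hf 1 (by simp)) (by simpa using hy)
  · have := lip_var hlip zero_le_one le_rfl
    rw [sub_zero, mul_one] at this
    exact this
end

section
/- Let X := {(t, n·(2−|t|)) ∈ ℝ² : n ∈ ℕ, n ≥ 1, t ∈ [−2,2]}, a subset of the Euclidean plane. Then for every integer n ≥ 1 and every continuous curve θ : [0,1] → ℝ² with θ(s) ∈ X for all s ∈ [0,1], θ(0) = (−1, n) and θ(1) = (1, n), the length ℓ(θ) is at least 2√(1+n²). In particular, since ‖(−1,n) − (1,n)‖ = 2, for no constant c ≥ 1 can every pair of points of X be joined inside X by a Lipschitz curve of length at most c times their distance, so X is not quasiconvex. -/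
/-- The point `(a, b)` of the Euclidean plane. -/
noncomputable def pt (a b : ℝ) : EuclideanSpace ℝ (Fin 2) :=
  (WithLp.equiv 2 (Fin 2 → ℝ)).symm ![a, b]

/-- The set `X = {(t, n·(2−|t|)) : n ∈ ℕ, n ≥ 1, t ∈ [−2,2]} ⊆ ℝ²`. -/
def Xset : Set (EuclideanSpace ℝ (Fin 2)) :=
  {p | ∃ n : ℕ, 1 ≤ n ∧ ∃ t ∈ Set.Icc (-2:ℝ) 2, p = pt t ((n : ℝ) * (2 - |t|))}

lemma pt_zero (a b : ℝ) : (pt a b) 0 = a := rfl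
lemma pt_one (a b : ℝ) : (pt a b) 1 = b := rfl

lemma dist_pt (a b c d : ℝ) : dist (pt a b) (pt c d) = Real.sqrt ((a - c) ^ 2 + (b - d) ^ 2) := by
  rw [EuclideanSpace.dist_eq]
  simp [Fin.sum_univ_two, pt_zero, pt_one, Real.dist_eq, sq_abs]

lemma len_ge (θ : ℝ → EuclideanSpace ℝ (Fin 2)) (s : ℝ) (hs : s ∈ Set.Icc (0:ℝ) 1) (r : ℝ)
    (h0 : r ≤ dist (θ 0) (θ s)) (h1 : r ≤ dist (θ s) (θ 1)) :
    ENNReal.ofReal (2 * r) ≤ eVariationOn θ (Set.Icc 0 1) := by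
  have e := eVariationOn.Icc_add_Icc θ (s := Set.univ) hs.1 hs.2 (Set.mem_univ s)
  simp only [Set.univ_inter] at e
  rw [← e]
  calc ENNReal.ofReal (2 * r) ≤ ENNReal.ofReal (dist (θ 0) (θ s) + dist (θ s) (θ 1)) :=
        ENNReal.ofReal_le_ofReal (by linarith)
    _ = edist (θ 0) (θ s) + edist (θ s) (θ 1) := by
        rw [ENNReal.ofReal_add dist_nonneg dist_nonneg, edist_dist, edist_dist]
    _ ≤ _ := add_le_add
        (eVariationOn.edist_le θ (Set.left_mem_Icc.2 hs.1) (Set.right_mem_Icc.2 hs.1))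
        (eVariationOn.edist_le θ (Set.left_mem_Icc.2 hs.2) (Set.right_mem_Icc.2 hs.2))

lemma part_one (n : ℕ) (θ : ℝ → EuclideanSpace ℝ (Fin 2))
    (hc : ContinuousOn θ (Set.Icc 0 1)) (hX : θ '' Set.Icc 0 1 ⊆ Xset)
    (h0 : θ 0 = pt (-1) (n : ℝ)) (h1 : θ 1 = pt 1 (n : ℝ)) :
    ENNReal.ofReal (2 * Real.sqrt (1 + (n : ℝ) ^ 2)) ≤ eVariationOn θ (Set.Icc 0 1) := by
  have key : ∃ s ∈ Set.Icc (0:ℝ) 1, θ s = pt 0 (2 * n) ∨ θ s = pt 2 0 ∨ θ s = pt (-2) 0 := by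
    by_contra! hcon
    have hx : ∀ i : Fin 2, ContinuousOn (fun s => θ s i) (Set.Icc 0 1) := fun i =>
      (EuclideanSpace.proj i : EuclideanSpace ℝ (Fin 2) →L[ℝ] ℝ).continuous.comp_continuousOn hc
    have hlt : ∀ s ∈ Set.Icc (0:ℝ) 1, 0 < 2 - |θ s 0| ∧
        ∃ m : ℕ, θ s 1 = m * (2 - |θ s 0|) ∧ θ s = pt (θ s 0) (m * (2 - |θ s 0|)) := by
      intro s hs
      obtain ⟨m, hm, t, ht, e⟩ := hX ⟨s, hs, rfl⟩
      obtain ⟨_, c2, c3⟩ := hcon s hs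
      have e0 : θ s 0 = t := by rw [e]; rfl
      have e1 : θ s 1 = m * (2 - |t|) := by rw [e]; rfl
      rw [e0]
      refine ⟨?_, m, e1, e⟩
      have : |t| ≤ 2 := abs_le.2 ht
      rcases this.lt_or_eq with h | h
      · linarith
      · exfalso
        rw [h] at e
        rcases (abs_eq (by norm_num)).1 h with h | h
        · apply c2; rw [e, h]; norm_num
        · apply c3; rw [e, h]; norm_num
    let r : ℝ → ℝ := fun s => θ s 1 / (2 - |θ s 0|)
    have hr : ContinuousOn r (Set.Icc 0 1) :=
      (hx 1).div (continuousOn_const.sub (hx 0).abs) (fun s hs => (hlt s hs).1.ne')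
    have hpre := isPreconnected_Icc.image r hr
    have hsub : r '' Set.Icc 0 1 ⊆ Set.range (fun m : ℕ => (m : ℝ)) := by
      rintro _ ⟨s, hs, rfl⟩
      obtain ⟨hp, m, hm, _⟩ := hlt s hs
      exact ⟨m, by simp only [r]; rw [hm]; field_simp⟩
    have hss := (Set.countable_range (fun m : ℕ => (m : ℝ))).isTotallyDisconnected _ hsub hpre
    obtain ⟨s, hs, hs0⟩ := intermediate_value_Icc (zero_le_one' ℝ) (hx 0)
      (show (0:ℝ) ∈ Set.Icc (θ 0 0) (θ 1 0) by rw [h0, h1, pt_zero, pt_zero]; norm_num)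
    have hs0 : θ s 0 = 0 := hs0
    have heq : r s = r 0 := hss ⟨s, hs, rfl⟩ ⟨0, by simp, rfl⟩
    have hr0 : r 0 = n := by
      simp only [r]; rw [h0, pt_zero, pt_one]; norm_num
    obtain ⟨hp, m, hm, e⟩ := hlt s hs
    have : r s = m := by simp only [r]; rw [hm]; field_simp
    have hmn : (m : ℝ) = n := by rw [← this, heq, hr0]
    apply (hcon s hs).1
    rw [e, hs0, hmn]
    norm_num [mul_comm]
  obtain ⟨s, hs, h⟩ := key
  apply len_ge θ s hs
  · rw [h0]
    rcases h with h | h | h <;> rw [h, dist_pt] <;> apply Real.sqrt_le_sqrt <;> nlinarith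
  · rw [h1]
    rcases h with h | h | h <;> rw [h, dist_pt] <;> apply Real.sqrt_le_sqrt <;> nlinarith

/-- Every continuous curve in `Xset` joining `(−1,n)` to `(1,n)` has length at least
`2√(1+n²)`; in particular, since those points are at distance `2`, `Xset` is not
quasiconvex. -/
theorem stmt_14 :
    (∀ n : ℕ, 1 ≤ n → ∀ θ : ℝ → EuclideanSpace ℝ (Fin 2),
      ContinuousOn θ (Set.Icc 0 1) → θ '' Set.Icc 0 1 ⊆ Xset →
      θ 0 = pt (-1) (n : ℝ) → θ 1 = pt 1 (n : ℝ) →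
      ENNReal.ofReal (2 * Real.sqrt (1 + (n : ℝ) ^ 2))
        ≤ eVariationOn θ (Set.Icc 0 1)) ∧
    ¬ ∃ c : ℝ, 1 ≤ c ∧ ∀ p ∈ Xset, ∀ q ∈ Xset,
      ∃ θ : ℝ → EuclideanSpace ℝ (Fin 2),
        (∃ L, LipschitzOnWith L θ (Set.Icc 0 1)) ∧ θ '' Set.Icc 0 1 ⊆ Xset ∧
        θ 0 = p ∧ θ 1 = q ∧
        eVariationOn θ (Set.Icc 0 1) ≤ ENNReal.ofReal (c * dist p q) := by
  refine ⟨fun n _ θ hc hX h0 h1 => part_one n θ hc hX h0 h1, ?_⟩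
  rintro ⟨c, hc, H⟩
  obtain ⟨n, hn⟩ := exists_nat_gt c
  have hn1 : 1 ≤ n := by
    have : (1:ℝ) < n := by linarith
    exact_mod_cast this.le
  obtain ⟨θ, ⟨L, hL⟩, hX, h0, h1, hv⟩ := H (pt (-1) n) ⟨n, hn1, -1, by norm_num, by norm_num⟩
    (pt 1 n) ⟨n, hn1, 1, by norm_num, by norm_num⟩
  have h := (part_one n θ hL.continuousOn hX h0 h1).trans hv
  have hd : dist (pt (-1) (n:ℝ)) (pt 1 n) = 2 := by
    rw [dist_pt, Real.sqrt_eq_iff_mul_self_eq (by positivity) (by norm_num)]; norm_num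
  rw [hd, ENNReal.ofReal_le_ofReal_iff (by linarith)] at h
  have : (n:ℝ) ≤ Real.sqrt (1 + (n:ℝ)^2) := Real.le_sqrt_of_sq_le (by linarith)
  linarith
end

section
/- There exist a closed, path-connected subset X of the Euclidean plane ℝ², a bounded set B ⊆ ℝ, and a Lipschitz map γ : B → X with E := γ(B) satisfying ℋ¹(E) = 1 (so E is a 1-rectifiable subset of X of positive finite measure), such that for every countable family of Lipschitz curves θ_n : [0,1] → ℝ² (n ∈ ℕ) with θ_n([0,1]) ⊆ X for every n, one has ℋ¹(E ∖ ⋃_n θ_n([0,1])) > 0. In other words, there is an arc-connected complete separable metric space containing a 1-rectifiable set that cannot be covered, up to an ℋ¹-negligible set, by countably many Lipschitz curves. -/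
open MeasureTheory

noncomputable def wig (t : ℝ) : ℝ := t * Real.sin (Real.pi / 2 * t⁻¹)

lemma wig_cont : Continuous wig := by
  rw [continuous_iff_continuousAt]
  intro t
  by_cases h : t = 0
  · subst h
    have h0 : wig 0 = 0 := by simp [wig]
    unfold ContinuousAt
    rw [h0]
    refine squeeze_zero_norm (a := fun t : ℝ => |t|) ?_ ?_
    · intro t
      rw [wig, norm_mul]
      calc ‖t‖ * ‖Real.sin (Real.pi / 2 * t⁻¹)‖ ≤ ‖t‖ * 1 := by
            gcongr
            exact Real.abs_sin_le_one _
        _ = |t| := by simp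
    · have : Filter.Tendsto (fun t : ℝ => |t|) (nhds 0) (nhds |0|) := continuous_abs.tendsto 0
      simpa using this
  · unfold wig
    fun_prop (disch := assumption)

lemma wig_a (n : ℕ) (hn : 0 < n) : wig (1 / (4 * n)) = 0 := by
  have : Real.pi / 2 * (1 / (4 * (n:ℝ)))⁻¹ = ((2 * n : ℕ) : ℝ) * Real.pi := by
    push_cast; field_simp; ring
  rw [wig, this, Real.sin_nat_mul_pi, mul_zero]

lemma wig_b (n : ℕ) : wig (1 / (4 * n + 1)) = 1 / (4 * n + 1) := by
  have : Real.pi / 2 * (1 / (4 * (n:ℝ) + 1))⁻¹ = Real.pi / 2 + (n : ℝ) * (2 * Real.pi) := by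
    rw [one_div, inv_inv]; ring
  rw [wig, this, Real.sin_add_nat_mul_two_pi, Real.sin_pi_div_two, mul_one]

lemma wig_div (N : ℕ) :
    ∑' k : ℕ, ENNReal.ofReal (1 / (4 * ((k + N : ℕ) : ℝ) + 1)) = ⊤ := by
  by_contra h
  have h1 : Summable fun k : ℕ => 1 / (4 * ((k + N : ℕ) : ℝ) + 1) := by
    have := ENNReal.summable_toReal h
    refine this.congr ?_
    intro k
    rw [ENNReal.toReal_ofReal (by positivity)]
  rw [summable_nat_add_iff (f := fun k : ℕ => 1 / (4 * (k : ℝ) + 1)) N] at h1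
  have h2 : Summable fun k : ℕ => 1 / ((k + 1 : ℕ) : ℝ) := by
    refine Summable.of_nonneg_of_le (fun k => by positivity) (fun k => ?_) (h1.mul_left 4)
    rw [mul_one_div, div_le_div_iff₀ (by positivity) (by positivity)]
    push_cast
    linarith
  rw [summable_nat_add_iff (f := fun k : ℕ => 1 / (k : ℝ)) 1] at h2
  exact Real.not_summable_one_div_natCast h2

lemma key (K : Set ℝ) (hK : IsClosed K) (hq : ∀ q : ℚ, (q : ℝ) ∉ K) (a b : ℝ → ℝ) (L : NNReal)
    (ha : ContinuousOn a (Set.Icc 0 1)) (hb : LipschitzOnWith L b (Set.Icc 0 1))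
    (hab : ∀ t ∈ Set.Icc (0:ℝ) 1, b t = wig (Metric.infDist (a t) K))
    (c : ℝ) (hc : c ∈ K) (u v : ℝ) (hu : u ∈ Set.Icc (0:ℝ) 1) (hv : v ∈ Set.Icc (0:ℝ) 1)
    (huc : a u < c) (hcv : c < a v) : False := by
  obtain ⟨q, hcq, hqv⟩ := exists_rat_btwn hcv
  have hcomp : IsCompact (K ∩ Set.Icc c q) := isCompact_Icc.inter_left hK
  obtain ⟨p, ⟨hpK, hcp, hpq⟩, hpmax⟩ := hcomp.exists_isGreatest ⟨c, hc, le_rfl, hcq.le⟩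
  have hpq' : p < q := lt_of_le_of_ne hpq (fun h => hq q (h ▸ hpK))
  have hdist : ∀ s : ℝ, 0 ≤ s → 2 * s ≤ q - p → Metric.infDist (p + s) K = s := by
    intro s hs hs2
    apply le_antisymm
    · refine (Metric.infDist_le_dist_of_mem hpK).trans ?_
      simp [Real.dist_eq, abs_of_nonneg hs]
    · rw [Metric.le_infDist ⟨p, hpK⟩]
      intro y hy
      rw [Real.dist_eq]
      by_cases hyq : y ≤ q
      · have : y ≤ p := by
          by_cases hyc : c ≤ y
          · exact hpmax ⟨hy, hyc, hyq⟩
          · linarith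
        exact le_trans (by linarith) (le_abs_self _)
      · exact le_trans (by linarith) (neg_le_abs _)
  obtain ⟨N, hN⟩ := exists_nat_gt (1 / (q - p))
  have hqp : 0 < (q:ℝ) - p := by linarith
  have hN0 : 0 < N := by
    have : 0 < 1 / ((q:ℝ) - p) := by positivity
    exact_mod_cast this.trans hN
  let T : ℕ → Set ℝ := fun k => Set.Icc 0 1 ∩
    a ⁻¹' (Set.Icc (p + 1 / (4 * ((k + N : ℕ) : ℝ) + 1)) (p + 1 / (4 * ((k + N : ℕ) : ℝ))))
  have hTm : ∀ k, MeasurableSet (T k) := fun k =>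
    (ha.preimage_isClosed_of_isClosed isClosed_Icc isClosed_Icc).measurableSet
  have hTd : Pairwise (Function.onFun Disjoint T) := by
    have aux : ∀ i j : ℕ, i < j → Disjoint (T i) (T j) := by
      intro i j hij
      rw [Set.disjoint_left]
      rintro t ⟨_, h1, _⟩ ⟨_, _, h2⟩
      have hij' : (i:ℝ) + 1 ≤ j := by exact_mod_cast hij
      have : 1 / (4 * ((j + N : ℕ) : ℝ)) < 1 / (4 * ((i + N : ℕ) : ℝ) + 1) := by
        apply one_div_lt_one_div_of_lt (by positivity)
        push_cast; linarith
      linarith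
    intro i j hij
    rcases lt_or_gt_of_ne hij with h | h
    · exact aux i j h
    · exact (aux j i h).symm
  have hT : ∀ k, ENNReal.ofReal (1 / (4 * ((k + N : ℕ) : ℝ) + 1)) ≤ L * volume (T k) := by
    intro k
    have hM : 0 < k + N := by omega
    have hMR : (N:ℝ) ≤ ((k + N : ℕ) : ℝ) := by exact_mod_cast (by omega)
    generalize hMd : k + N = M at hM hMR
    have hMpos : (0:ℝ) < M := by exact_mod_cast hM
    have hsub : Set.Icc 0 (1 / (4 * (M:ℝ) + 1)) ⊆ b '' (T k) := by
      have hle : 1 / (4 * (M:ℝ) + 1) ≤ 1 / (4 * (M:ℝ)) :=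
        one_div_le_one_div_of_le (by positivity) (by linarith)
      have hiv := intermediate_value_Icc' hle wig_cont.continuousOn
      rw [wig_a M hM, wig_b M] at hiv
      intro y hy
      obtain ⟨s, hs, rfl⟩ := hiv hy
      have hs0 : 0 ≤ s := le_trans (by positivity) hs.1
      have hs2 : 2 * s ≤ q - p := by
        have h1 : s ≤ 1 / (4 * (M:ℝ)) := hs.2
        have h2 : 1 / (q - p) < (M:ℝ) := hN.trans_le hMR
        rw [div_lt_iff₀ hqp] at h2
        rw [le_div_iff₀ (by positivity)] at h1
        by_contra hcon
        push Not at hcon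
        nlinarith
      have hmem : p + s ∈ Set.Icc (a u) (a v) := ⟨by linarith, by linarith⟩
      have hoc : (a '' Set.Icc 0 1).OrdConnected :=
        ((isPreconnected_Icc).image a ha).ordConnected
      obtain ⟨t, ht, hts⟩ := hoc.out ⟨u, hu, rfl⟩ ⟨v, hv, rfl⟩ hmem
      refine ⟨t, ⟨ht, ?_⟩, ?_⟩
      · rw [hMd, Set.mem_preimage, hts]
        exact ⟨by linarith [hs.1], by linarith [hs.2]⟩
      · rw [hab t ht, hts, hdist s hs0 hs2]
    have h1 := (hb.mono (Set.inter_subset_left : T k ⊆ _)).hausdorffMeasure_image_le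
      (d := 1) zero_le_one
    rw [hausdorffMeasure_real, ENNReal.rpow_one] at h1
    calc _ = volume (Set.Icc 0 (1 / (4 * (M:ℝ) + 1))) := by rw [Real.volume_Icc, sub_zero]
      _ ≤ volume (b '' T k) := measure_mono hsub
      _ ≤ _ := h1
  have hsum : (⊤ : ENNReal) ≤ L * 1 := by
    calc (⊤ : ENNReal) = ∑' k : ℕ, ENNReal.ofReal (1 / (4 * ((k + N : ℕ) : ℝ) + 1)) :=
          (wig_div N).symm
      _ ≤ ∑' k, L * volume (T k) := ENNReal.tsum_le_tsum hT
      _ = L * volume (⋃ k, T k) := by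
          rw [ENNReal.tsum_mul_left, measure_iUnion hTd hTm]
      _ ≤ L * volume (Set.Icc (0:ℝ) 1) := by
          gcongr
          exact Set.iUnion_subset fun k => Set.inter_subset_left
      _ = L * 1 := by simp
  simp at hsum

lemma exK : ∃ K B : Set ℝ, IsClosed K ∧ (∀ q : ℚ, (q : ℝ) ∉ K) ∧ B ⊆ K ∧
    Bornology.IsBounded B ∧ volume B = 1 := by
  have h0 : volume (Set.range ((↑) : ℚ → ℝ)) < 1 := by
    rw [(Set.countable_range _).measure_zero]; exact zero_lt_one
  obtain ⟨U, hU, hUo, hU1⟩ := Set.exists_isOpen_lt_of_lt _ _ h0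
  have hKm : MeasurableSet Uᶜ := hUo.measurableSet.compl
  let φ : ℝ → ℝ := fun r => (volume (Uᶜ ∩ Set.Icc 0 r)).toReal
  have hfin : ∀ r, volume (Uᶜ ∩ Set.Icc 0 r) ≠ ⊤ := fun r =>
    ((measure_mono Set.inter_subset_right).trans_lt measure_Icc_lt_top).ne
  have hφ : ∀ r s, r ≤ s → φ r ≤ φ s ∧ φ s ≤ φ r + (s - r) := by
    intro r s hrs
    constructor
    · exact ENNReal.toReal_mono (hfin s) (by gcongr)
    · have : volume (Uᶜ ∩ Set.Icc 0 s) ≤ volume (Uᶜ ∩ Set.Icc 0 r) + ENNReal.ofReal (s - r) := by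
        rw [← Real.volume_Ioc]
        refine le_trans (measure_mono ?_) (measure_union_le _ _)
        rintro x ⟨hx, hx0, hxs⟩
        by_cases h : x ≤ r
        · exact Or.inl ⟨hx, hx0, h⟩
        · exact Or.inr ⟨not_le.1 h, hxs⟩
      have h2 := ENNReal.toReal_mono (by simp [hfin]) this
      rwa [ENNReal.toReal_add (hfin r) (by simp), ENNReal.toReal_ofReal (by linarith)] at h2
  have hlip : LipschitzWith 1 φ := by
    apply LipschitzWith.of_dist_le_mul
    intro r s
    simp only [Real.dist_eq, NNReal.coe_one, one_mul]
    rcases le_total r s with h | h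
    · obtain ⟨h1, h2⟩ := hφ r s h
      rw [abs_sub_comm, abs_sub_comm r, abs_of_nonneg (by linarith), abs_of_nonneg (by linarith)]
      linarith
    · obtain ⟨h1, h2⟩ := hφ s r h
      rw [abs_of_nonneg (by linarith), abs_of_nonneg (by linarith)]
      linarith
  have hφ0 : φ 0 ≤ 1 := by
    simp only [φ]
    rw [Set.Icc_self, measure_mono_null Set.inter_subset_right (by simp)]
    simp
  have hφ2 : 1 ≤ φ 2 := by
    have h1 : volume (Set.Icc (0:ℝ) 2) ≤ volume U + volume (Uᶜ ∩ Set.Icc 0 2) := by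
      refine le_trans (measure_mono ?_) (measure_union_le _ _)
      intro x hx
      by_cases h : x ∈ U
      · exact Or.inl h
      · exact Or.inr ⟨h, hx⟩
    have h2 := ENNReal.toReal_mono (by simp [hfin, hU1.ne_top]) h1
    rw [ENNReal.toReal_add hU1.ne_top (hfin 2), Real.volume_Icc,
      ENNReal.toReal_ofReal (by norm_num)] at h2
    have h3 : (volume U).toReal ≤ 1 := by
      have := ENNReal.toReal_mono ENNReal.one_ne_top hU1.le
      simpa using this
    change 1 ≤ (volume (Uᶜ ∩ Set.Icc 0 2)).toReal
    linarith
  obtain ⟨r, hr, hr1⟩ := intermediate_value_Icc (by norm_num : (0:ℝ) ≤ 2)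
    hlip.continuous.continuousOn ⟨hφ0, hφ2⟩
  refine ⟨Uᶜ, Uᶜ ∩ Set.Icc 0 r, hUo.isClosed_compl, fun q h => h (hU ⟨q, rfl⟩),
    Set.inter_subset_left, (Metric.isBounded_Icc 0 r).subset Set.inter_subset_right, ?_⟩
  rw [← ENNReal.ofReal_toReal (hfin r)]
  change ENNReal.ofReal (φ r) = 1
  rw [hr1]; simp

/-- There exist a closed, path-connected subset `X` of the Euclidean plane, a bounded set
`B ⊆ ℝ` and a Lipschitz map `γ` on `B` with image `E := γ(B) ⊆ X` of `ℋ¹`-measure `1`,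
such that `E` cannot be covered, up to an `ℋ¹`-negligible set, by countably many Lipschitz
curves contained in `X`. -/
theorem stmt_15 :
    ∃ (X : Set (EuclideanSpace ℝ (Fin 2))) (B : Set ℝ)
      (γ : ℝ → EuclideanSpace ℝ (Fin 2)),
      IsClosed X ∧ IsPathConnected X ∧ Bornology.IsBounded B ∧
      (∃ L, LipschitzOnWith L γ B) ∧ γ '' B ⊆ X ∧
      μH[1] (γ '' B) = 1 ∧
      ∀ θ : ℕ → ℝ → EuclideanSpace ℝ (Fin 2),
        (∀ n, ∃ L, LipschitzOnWith L (θ n) (Set.Icc 0 1)) →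
        (∀ n, θ n '' Set.Icc 0 1 ⊆ X) →
        0 < μH[1] ((γ '' B) \ ⋃ n, θ n '' Set.Icc 0 1) := by
  obtain ⟨K, B, hK, hq, hBK, hBb, hB1⟩ := exK
  have hfc : Continuous fun x : ℝ => wig (Metric.infDist x K) :=
    wig_cont.comp (Metric.continuous_infDist_pt K)
  have hiso : Isometry fun x : ℝ => (!₂[x, 0] : EuclideanSpace ℝ (Fin 2)) := by
    apply Isometry.of_dist_eq
    intro x y
    simp [EuclideanSpace.dist_eq, Real.dist_eq, Real.sqrt_sq_eq_abs]
  have hmeas : μH[1] ((fun x : ℝ => (!₂[x, 0] : EuclideanSpace ℝ (Fin 2))) '' B) = 1 := by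
    rw [hiso.hausdorffMeasure_image (Or.inl zero_le_one), hausdorffMeasure_real, hB1]
  have hproj : ∀ i : Fin 2, LipschitzWith 1 fun x : EuclideanSpace ℝ (Fin 2) => x i := by
    intro i
    apply LipschitzWith.of_dist_le_mul
    intro x y
    rw [NNReal.coe_one, one_mul, dist_eq_norm, dist_eq_norm]
    exact PiLp.norm_apply_le (x - y) i
  refine ⟨{x | x 1 = wig (Metric.infDist (x 0) K)}, B, fun x => !₂[x, 0], ?_, ?_, hBb,
    ⟨1, hiso.lipschitz.lipschitzOnWith⟩, ?_, hmeas, ?_⟩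
  · exact isClosed_eq (hproj 1).continuous (hfc.comp (hproj 0).continuous)
  · have : {x : EuclideanSpace ℝ (Fin 2) | x 1 = wig (Metric.infDist (x 0) K)} =
        Set.range fun x : ℝ => (!₂[x, wig (Metric.infDist x K)] : EuclideanSpace ℝ (Fin 2)) := by
      ext x
      constructor
      · intro h
        refine ⟨x 0, ?_⟩
        ext i
        fin_cases i
        · simp
        · simpa using h.symm
      · rintro ⟨y, rfl⟩
        simp
    rw [this]
    apply isPathConnected_range
    apply (PiLp.continuous_toLp 2 _).comp
    rw [continuous_pi_iff]
    intro i
    fin_cases i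
    · exact continuous_id
    · simpa using hfc
  · rintro _ ⟨x, hx, rfl⟩
    simp [Metric.infDist_zero_of_mem (hBK hx), wig]
  · intro θ hθ hX
    have hcount : ∀ n, (K ∩ (fun t => θ n t 0) '' Set.Icc 0 1).Countable := by
      intro n
      obtain ⟨L, hL⟩ := hθ n
      have hca : ContinuousOn (fun t => θ n t 0) (Set.Icc 0 1) :=
        (hproj 0).continuous.comp_continuousOn hL.continuousOn
      have hlb : LipschitzOnWith (1 * L) (fun t => θ n t 1) (Set.Icc 0 1) :=
        (hproj 1).comp_lipschitzOnWith hL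
      have hcomp := isCompact_Icc.image_of_continuousOn hca
      have hne : ((fun t => θ n t 0) '' Set.Icc (0:ℝ) 1).Nonempty := ⟨_, 0, by simp, rfl⟩
      obtain ⟨m, ⟨u, hu, hum⟩, hm⟩ := hcomp.exists_isLeast hne
      obtain ⟨M, ⟨v, hv, hvM⟩, hM⟩ := hcomp.exists_isGreatest hne
      refine (Set.toFinite {m, M}).countable.mono ?_
      rintro c ⟨hcK, hc⟩
      by_contra hcon
      simp only [Set.mem_insert_iff, Set.mem_singleton_iff, not_or] at hcon
      refine key K hK hq _ _ _ hca hlb (fun t ht => hX n ⟨t, ht, rfl⟩) c hcK u v hu hv ?_ ?_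
      · exact lt_of_le_of_ne (hum.trans_le (hm hc)) (fun h => hcon.1 (h.symm.trans hum))
      · exact lt_of_le_of_ne ((hM hc).trans_eq hvM.symm) (fun h => hcon.2 (h.trans hvM))
    let S : Set ℝ := ⋃ n, (K ∩ (fun t => θ n t 0) '' Set.Icc 0 1)
    have hS : volume S = 0 := (Set.countable_iUnion hcount).measure_zero _
    have hsub : (fun x : ℝ => (!₂[x, 0] : EuclideanSpace ℝ (Fin 2))) '' (B \ S) ⊆
        ((fun x : ℝ => (!₂[x, 0] : EuclideanSpace ℝ (Fin 2))) '' B) \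
          ⋃ n, θ n '' Set.Icc 0 1 := by
      rintro _ ⟨x, ⟨hx, hxS⟩, rfl⟩
      refine ⟨⟨x, hx, rfl⟩, fun h => hxS ?_⟩
      obtain ⟨n, t, ht, hxt⟩ := Set.mem_iUnion.1 h
      refine Set.mem_iUnion.2 ⟨n, hBK hx, t, ht, ?_⟩
      simp [hxt]
    refine lt_of_lt_of_le ?_ (measure_mono hsub)
    rw [hiso.hausdorffMeasure_image (Or.inl zero_le_one), hausdorffMeasure_real,
      measure_sdiff_null hS, hB1]
    exact zero_lt_one
end
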